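/- arXiv:2209.03243 — 3 statements merged into one kernel-verified Lean document; each statement's English description precedes it below -/
import Mathlib

section
/- First-order stochastic dominance for one-step truncated Euler kernels: Let b : ℝ → ℝ be Lipschitz with constant C₀ and σ : ℝ → [0,∞) be Lipschitz with constant C₁. Let h > 0 and A ≥ 0 satisfy hC₀ + AC₁ ≤ 1, and let Δ be a real random variable with |Δ| ≤ A almost surely. Then for all x ≤ x′ and every a ∈ ℝ, P(x′ + h b(x′) + σ(x′)Δ ≤ a) ≤ P(x + h b(x) + σ(x)Δ ≤ a); that is, the law of x′ + h b(x′) + σ(x′)Δ dominates the law of x + h b(x) + σ(x)Δ in first order stochastic dominance. -/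
open MeasureTheory
open scoped NNReal

/-- **First-order stochastic dominance for one-step truncated Euler kernels.**
If `b` is `C₀`-Lipschitz, `σ ≥ 0` is `C₁`-Lipschitz, `h > 0`, `A ≥ 0` with
`hC₀ + AC₁ ≤ 1`, and `Δ` is a random variable with `|Δ| ≤ A` a.s., then for all
`x ≤ x′` and every `a ∈ ℝ`,
`P(x′ + h b(x′) + σ(x′)Δ ≤ a) ≤ P(x + h b(x) + σ(x)Δ ≤ a)`. -/
theorem fosd_truncated_euler_kernel
    {Ω : Type*} [MeasurableSpace Ω] (P : Measure Ω) [IsProbabilityMeasure P]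
    (b σ : ℝ → ℝ) (C₀ C₁ : ℝ≥0)
    (hb : LipschitzWith C₀ b) (hσ : LipschitzWith C₁ σ) (hσnonneg : ∀ x, 0 ≤ σ x)
    (h A : ℝ) (hh : 0 < h) (hA : 0 ≤ A)
    (hcond : h * C₀ + A * C₁ ≤ 1)
    (Δ : Ω → ℝ) (hΔmeas : Measurable Δ) (hΔ : ∀ᵐ ω ∂P, |Δ ω| ≤ A) :
    ∀ x x' : ℝ, x ≤ x' → ∀ a : ℝ,
      P {ω | x' + h * b x' + σ x' * Δ ω ≤ a} ≤ P {ω | x + h * b x + σ x * Δ ω ≤ a} := by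
  intro x x' hx a
  apply measure_mono_ae
  filter_upwards [hΔ] with ω hω hle
  have hle' : x' + h * b x' + σ x' * Δ ω ≤ a := hle
  show x + h * b x + σ x * Δ ω ≤ a
  have h1 := hb.dist_le_mul x' x
  have h2 := hσ.dist_le_mul x' x
  rw [Real.dist_eq, Real.dist_eq, abs_of_nonneg (sub_nonneg.2 hx)] at h1 h2
  have h3 : h * (-(C₀ * (x' - x))) ≤ h * (b x' - b x) :=
    mul_le_mul_of_nonneg_left (abs_le.1 h1).1 hh.le
  have h4 : |(σ x' - σ x) * Δ ω| ≤ C₁ * (x' - x) * A := by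
    rw [abs_mul]
    exact mul_le_mul h2 hω (abs_nonneg _) ((abs_nonneg _).trans h2)
  have h5 := (abs_le.1 h4).1
  have h6 := mul_le_mul_of_nonneg_right hcond (sub_nonneg.2 hx)
  nlinarith
end

section
/- Fourth-moment bound for the truncated Brownian increment: Let W be a standard one-dimensional Brownian motion, let h ∈ (0,1], set A_h := 4√(h log(1/h)), and let τ := inf{t ≥ 0 : |W_t| ≥ A_h} be the first exit time of W from (−A_h, A_h). Then E[(W_h − W_{h∧τ})⁴] ≤ 6 h^{10}. -/
open MeasureTheory ProbabilityTheory
open scoped NNReal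

/-- A standard one-dimensional Brownian motion (Wiener process) on a probability space:
a process `W` with `W 0 = 0`, a.s. continuous paths, Gaussian increments
`W t − W s ~ N(0, t − s)` for `0 ≤ s ≤ t`, each such increment being independent of
the past `σ(W r : 0 ≤ r ≤ s)`.  (Equivalently, a continuous centered Gaussian process
with `W 0 = 0` and covariance `Cov(W s, W t) = min s t`.) -/
structure IsBrownianMotion {Ω : Type*} [MeasurableSpace Ω] (P : Measure Ω)
    (W : ℝ → Ω → ℝ) : Prop where
  isProb : IsProbabilityMeasure P
  meas : ∀ t, Measurable (W t)
  start : ∀ ω, W 0 ω = 0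
  cont : ∀ᵐ ω ∂P, Continuous fun t => W t ω
  incr : ∀ s t : ℝ, 0 ≤ s → s ≤ t →
    P.map (fun ω => W t ω - W s ω) = gaussianReal 0 (Real.toNNReal (t - s))
  indep : ∀ s t : ℝ, 0 ≤ s → s ≤ t →
    Indep (MeasurableSpace.comap (fun ω => W t ω - W s ω) inferInstance)
      (⨆ r ∈ Set.Icc (0 : ℝ) s, MeasurableSpace.comap (W r) inferInstance) P

lemma bm_gauss_fourth (v : ℝ≥0) :
    ∫⁻ x, ENNReal.ofReal (x ^ 4) ∂(gaussianReal 0 v) = ENNReal.ofReal (3 * (v:ℝ) ^ 2) := by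
  have hint : Integrable (fun x : ℝ => x ^ 4) (gaussianReal 0 v) := by
    have h := (memLp_id_gaussianReal (μ := 0) (v := v) 4).integrable_norm_pow (by norm_num)
    refine h.congr (Filter.Eventually.of_forall fun x => ?_)
    simp only [id, Real.norm_eq_abs]
    have : |x| ^ 4 = x ^ 4 := Even.pow_abs (by decide) x
    simpa using this
  rw [← ofReal_integral_eq_lintegral_ofReal hint
    (Filter.Eventually.of_forall fun x => by positivity)]
  congr 1
  have h1 := iteratedDeriv_mgf_zero (X := id) (μ := gaussianReal 0 v) (by simp) 4
  have h2 : mgf id (gaussianReal 0 v) = fun t => Real.exp (v * t ^ 2 / 2) := by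
    rw [mgf_id_gaussianReal]; simp
  have key : ∀ (p p' : ℝ → ℝ), (∀ t, HasDerivAt p (p' t) t) →
      deriv (fun t => p t * Real.exp (v * t ^ 2 / 2)) =
        fun t => (p' t + p t * (v * t)) * Real.exp (v * t ^ 2 / 2) := by
    intro p p' hp
    ext t
    have he : HasDerivAt (fun t : ℝ => (v:ℝ) * t ^ 2 / 2) (v * t) t := by
      have := ((hasDerivAt_pow 2 t).const_mul (v:ℝ)).div_const 2
      exact this.congr_deriv (by norm_num; ring)
    have := ((hp t).mul he.exp).deriv
    rw [show (fun t => p t * Real.exp (v * t ^ 2 / 2)) = p * fun t => Real.exp (v * t ^ 2 / 2) from rfl, this]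
    ring
  have e1 : deriv (fun t : ℝ => Real.exp (v * t ^ 2 / 2)) =
      fun t => ((v:ℝ) * t) * Real.exp (v * t ^ 2 / 2) := by
    have := key (fun _ => 1) (fun _ => 0) (fun t => hasDerivAt_const _ _)
    simpa using this
  have e2 := key (fun t => v * t) (fun t => v) (fun t => by
    simpa using (hasDerivAt_id t).const_mul (v:ℝ))
  have e3 := key (fun t => v + v * t * (v * t)) (fun t => 2 * v ^ 2 * t) (fun t => by
    have := ((hasDerivAt_pow 2 t).const_mul ((v:ℝ)^2)).const_add (v:ℝ)
    rw [show (fun t : ℝ => (v:ℝ) + v * t * (v * t)) = fun t => (v:ℝ) + v ^ 2 * t ^ 2 by ext; ring]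
    exact this.congr_deriv (by norm_num; ring))
  have e4 := key (fun t => 2 * v ^ 2 * t + (v + v * t * (v * t)) * (v * t))
    (fun t => 3 * v ^ 2 + 3 * v ^ 3 * t ^ 2) (fun t => by
    have := ((hasDerivAt_id t).const_mul (3 * (v:ℝ)^2)).add
      ((hasDerivAt_pow 3 t).const_mul ((v:ℝ)^3))
    rw [show (fun t : ℝ => 2 * (v:ℝ) ^ 2 * t + (v + v * t * (v * t)) * (v * t)) =
      (fun y => 3 * (v:ℝ) ^ 2 * id y) + fun y => (v:ℝ) ^ 3 * y ^ 3 by ext; simp; ring]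
    exact this.congr_deriv (by norm_num; ring))
  rw [h2, iteratedDeriv_succ, iteratedDeriv_succ, iteratedDeriv_succ, iteratedDeriv_succ,
    iteratedDeriv_zero, e1, e2, e3, e4] at h1
  simp at h1
  exact h1.symm

lemma bm_gauss_exp (v : ℝ≥0) (l : ℝ) :
    ∫⁻ x, ENNReal.ofReal (Real.exp (l * x)) ∂(gaussianReal 0 v)
      = ENNReal.ofReal (Real.exp (v * l ^ 2 / 2)) := by
  rw [← ofReal_integral_eq_lintegral_ofReal (integrable_exp_mul_gaussianReal l)
    (Filter.Eventually.of_forall fun x => by positivity)]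
  congr 1
  have := congrFun (mgf_id_gaussianReal (μ := 0) (v := v)) l
  simpa [mgf] using this

section
variable {Ω : Type*} [MeasurableSpace Ω] {P : Measure Ω} {W : ℝ → Ω → ℝ}

set_option linter.unusedSectionVars false
/-- past sigma algebra -/
@[reducible]
def bmPast (W : ℝ → Ω → ℝ) (s : ℝ) : MeasurableSpace Ω :=
  ⨆ r ∈ Set.Icc (0 : ℝ) s, MeasurableSpace.comap (W r) inferInstance

lemma bmPast_le (hW : IsBrownianMotion P W) (s : ℝ) : bmPast W s ≤ ‹MeasurableSpace Ω› := by
  refine iSup₂_le fun r _ => ?_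
  exact (hW.meas r).comap_le

lemma bmPast_meas (W : ℝ → Ω → ℝ) {r s : ℝ} (h0 : 0 ≤ r) (hr : r ≤ s) :
    Measurable[bmPast W s] (W r) := by
  have : MeasurableSpace.comap (W r) inferInstance ≤ bmPast W s :=
    le_iSup₂_of_le (f := fun r (_ : r ∈ Set.Icc (0:ℝ) s) => MeasurableSpace.comap (W r) inferInstance)
      r ⟨h0, hr⟩ le_rfl
  exact (comap_measurable (W r)).mono this le_rfl

lemma bm_split (hW : IsBrownianMotion P W) {s t : ℝ} (hs : 0 ≤ s) (hst : s ≤ t)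
    (f : ℝ → ENNReal) (hf : Measurable f) (g : Ω → ENNReal) (hg : Measurable[bmPast W s] g) :
    ∫⁻ ω, f (W t ω - W s ω) * g ω ∂P =
      (∫⁻ x, f x ∂(gaussianReal 0 (Real.toNNReal (t - s)))) * ∫⁻ ω, g ω ∂P := by
  have hm : Measurable (fun ω => W t ω - W s ω) := (hW.meas t).sub (hW.meas s)
  rw [lintegral_mul_eq_lintegral_mul_lintegral_of_independent_measurableSpace hm.comap_le
    (bmPast_le hW s) (hW.indep s t hs hst)
    (f := fun ω => f (W t ω - W s ω)) (hf.comp (comap_measurable _)) hg,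
    ← hW.incr s t hs hst, lintegral_map hf hm]

/-- first hit of level `B` along the grid at index `k` -/
def bmFirst (W : ℝ → Ω → ℝ) (t : ℕ → ℝ) (B : ℝ) (k : ℕ) : Set Ω :=
  {ω | B ≤ |W (t k) ω| ∧ ∀ j ∈ Finset.range k, |W (t j) ω| < B}

lemma bmFirst_meas (W : ℝ → Ω → ℝ) {t : ℕ → ℝ} (ht : Monotone t) (h0 : 0 ≤ t 0) (B : ℝ) (k : ℕ) :
    MeasurableSet[bmPast W (t k)] (bmFirst W t B k) := by
  have hm : ∀ j ≤ k, Measurable[bmPast W (t k)] fun ω => |W (t j) ω| := fun j hj => by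
    have := bmPast_meas W (h0.trans (ht (Nat.zero_le j))) (ht hj)
    exact continuous_abs.measurable.comp this
  have : bmFirst W t B k = {ω | B ≤ |W (t k) ω|} ∩
      ⋂ j ∈ Finset.range k, {ω | |W (t j) ω| < B} := by
    ext; simp [bmFirst]
  rw [this]
  refine MeasurableSet.inter ((hm k le_rfl) measurableSet_Ici) ?_
  refine Finset.measurableSet_biInter _ fun j hj => (hm j (Finset.mem_range.1 hj).le) measurableSet_Iio

lemma bmFirst_disj (W : ℝ → Ω → ℝ) (t : ℕ → ℝ) (B : ℝ) :
    Pairwise (Function.onFun Disjoint (bmFirst W t B)) := by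
  have key : ∀ i j, i < j → Disjoint (bmFirst W t B i) (bmFirst W t B j) := by
    intro i j hij
    rw [Set.disjoint_left]
    rintro ω ⟨h1, _⟩ ⟨_, h2⟩
    exact absurd (h2 i (Finset.mem_range.2 hij)) (not_lt.2 h1)
  intro i j hij
  rcases lt_or_gt_of_ne hij with h | h
  · exact key i j h
  · exact (key j i h).symm

lemma bm_exp_step (hW : IsBrownianMotion P W) {s h : ℝ} (hs : 0 ≤ s) (hst : s ≤ h)
    {S : Set Ω} (hS : MeasurableSet[bmPast W s] S) (l : ℝ) :
    ∫⁻ ω in S, ENNReal.ofReal (Real.exp (l * W s ω)) ∂P ≤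
      ∫⁻ ω in S, ENNReal.ofReal (Real.exp (l * W h ω)) ∂P := by
  have hS' := bmPast_le hW s _ hS
  rw [← lintegral_indicator hS', ← lintegral_indicator hS']
  have hg : Measurable[bmPast W s]
      (S.indicator fun ω => ENNReal.ofReal (Real.exp (l * W s ω))) := by
    refine Measurable.indicator ?_ hS
    have := bmPast_meas W hs (le_refl s)
    have hc : Measurable fun x : ℝ => ENNReal.ofReal (Real.exp (l * x)) := by fun_prop
    exact hc.comp this
  have := bm_split hW hs hst (fun x => ENNReal.ofReal (Real.exp (l * x))) (by fun_prop) _ hg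
  rw [bm_gauss_exp] at this
  have e : (S.indicator fun ω => ENNReal.ofReal (Real.exp (l * W h ω))) =
      fun ω => ENNReal.ofReal (Real.exp (l * (W h ω - W s ω))) *
        (S.indicator fun ω => ENNReal.ofReal (Real.exp (l * W s ω))) ω := by
    ext ω
    by_cases hω : ω ∈ S
    · simp only [Set.indicator_of_mem hω]
      rw [← ENNReal.ofReal_mul (by positivity), ← Real.exp_add]
      congr 2; ring
    · simp [Set.indicator_of_notMem hω]
  rw [e, this]
  refine le_mul_of_one_le_left (by simp) ?_
  rw [ENNReal.one_le_ofReal, Real.one_le_exp_iff]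
  positivity

lemma bm_exp_total (hW : IsBrownianMotion P W) {h : ℝ} (hh : 0 ≤ h) (l : ℝ) :
    ∫⁻ ω, ENNReal.ofReal (Real.exp (l * W h ω)) ∂P = ENNReal.ofReal (Real.exp (h * l ^ 2 / 2)) := by
  have := bm_gauss_exp (Real.toNNReal (h - 0)) l
  rw [← hW.incr 0 h le_rfl hh, lintegral_map (by fun_prop) (show Measurable fun ω => W h ω - W 0 ω from
      (hW.meas h).sub (hW.meas 0))] at this
  simpa [hW.start, hh] using this

lemma bm_max (hW : IsBrownianMotion P W) {h B : ℝ} (hh : 0 < h) (hB : 0 ≤ B)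
    {t : ℕ → ℝ} (ht : Monotone t) (h0 : 0 ≤ t 0) (n : ℕ) (htn : t n ≤ h) :
    ∑ k ∈ Finset.range (n + 1), P (bmFirst W t B k) ≤
      ENNReal.ofReal (2 * Real.exp (- (B ^ 2 / (2 * h)))) := by
  set l := B / h with hl
  have hl0 : 0 ≤ l := by positivity
  have t0 : ∀ k, 0 ≤ t k := fun k => h0.trans (ht (Nat.zero_le k))
  have mS : ∀ k, MeasurableSet (bmFirst W t B k) := fun k =>
    bmPast_le hW _ _ (bmFirst_meas W ht h0 B k)
  have step : ∀ k ∈ Finset.range (n + 1), ENNReal.ofReal (Real.exp (l * B)) * P (bmFirst W t B k) ≤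
      ∫⁻ ω in bmFirst W t B k, (ENNReal.ofReal (Real.exp (l * W h ω)) +
        ENNReal.ofReal (Real.exp ((-l) * W h ω))) ∂P := by
    intro k hk
    have hkn : t k ≤ h := (ht (Nat.lt_succ_iff.1 (Finset.mem_range.1 hk))).trans htn
    have a1 := bm_exp_step hW (t0 k) hkn (bmFirst_meas W ht h0 B k) l
    have a2 := bm_exp_step hW (t0 k) hkn (bmFirst_meas W ht h0 B k) (-l)
    have mW := hW.meas h
    have mW' := hW.meas (t k)
    rw [lintegral_add_left (by fun_prop)]
    refine le_trans ?_ (add_le_add a1 a2)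
    rw [← lintegral_add_left (by fun_prop), ← setLIntegral_const]
    refine setLIntegral_mono' (mS k) fun ω hω => ?_
    have hb : B ≤ |W (t k) ω| := hω.1
    rcases abs_cases (W (t k) ω) with ⟨e, _⟩ | ⟨e, _⟩
    · refine le_add_right (ENNReal.ofReal_le_ofReal (Real.exp_le_exp.2 ?_))
      rw [e] at hb
      exact mul_le_mul_of_nonneg_left hb hl0
    · refine le_add_left (ENNReal.ofReal_le_ofReal (Real.exp_le_exp.2 ?_))
      rw [e] at hb
      nlinarith
  have hsum := Finset.sum_le_sum step
  rw [← Finset.mul_sum, ← lintegral_biUnion_finset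
    (fun i _ j _ hij => bmFirst_disj W t B hij) (fun k _ => mS k)] at hsum
  have h2 := hsum.trans (setLIntegral_le_lintegral _ _)
  rw [lintegral_add_left (by have := hW.meas h; fun_prop), bm_exp_total hW hh.le, bm_exp_total hW hh.le,
    ← ENNReal.ofReal_add (by positivity) (by positivity)] at h2
  have h3 := mul_le_mul_right h2 (ENNReal.ofReal (Real.exp (-(l * B))))
  rw [← mul_assoc, ← ENNReal.ofReal_mul (by positivity), ← Real.exp_add,
    ← ENNReal.ofReal_mul (by positivity)] at h3
  simp only [neg_add_cancel, Real.exp_zero, ENNReal.ofReal_one, one_mul] at h3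
  refine h3.trans_eq ?_
  congr 1
  have e1 : Real.exp (-(B ^ 2 / (2 * h))) = Real.exp (-(l * B)) * Real.exp (h * l ^ 2 / 2) := by
    rw [← Real.exp_add]; congr 1; rw [hl]; field_simp; ring
  rw [e1, neg_sq]; ring

lemma bm_disc (hW : IsBrownianMotion P W) {h B : ℝ} (hh : 0 < h) (hB : 0 ≤ B)
    {t : ℕ → ℝ} (ht : Monotone t) (h0 : 0 ≤ t 0) (n : ℕ) (htn : t n ≤ h) :
    ∫⁻ ω, ∑ k ∈ Finset.range (n + 1), ENNReal.ofReal ((W h ω - W (t k) ω) ^ 4) *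
      (bmFirst W t B k).indicator 1 ω ∂P ≤
      ENNReal.ofReal (3 * h ^ 2 * (2 * Real.exp (- (B ^ 2 / (2 * h))))) := by
  have mS : ∀ k, MeasurableSet (bmFirst W t B k) := fun k =>
    bmPast_le hW _ _ (bmFirst_meas W ht h0 B k)
  have t0 : ∀ k, 0 ≤ t k := fun k => h0.trans (ht (Nat.zero_le k))
  rw [lintegral_finsetSum']
  · rw [ENNReal.ofReal_mul (by positivity)]
    refine le_trans ?_ (mul_le_mul_right (bm_max hW hh hB ht h0 n htn) _)
    rw [Finset.mul_sum]
    refine Finset.sum_le_sum fun k hk => ?_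
    have hkn : t k ≤ h := (ht (Nat.lt_succ_iff.1 (Finset.mem_range.1 hk))).trans htn
    have := bm_split hW (t0 k) hkn (fun x => ENNReal.ofReal (x ^ 4)) (by fun_prop)
      ((bmFirst W t B k).indicator 1) (Measurable.indicator measurable_const (bmFirst_meas W ht h0 B k))
    rw [this, bm_gauss_fourth, lintegral_indicator_one (mS k)]
    refine mul_le_mul_left (ENNReal.ofReal_le_ofReal ?_) _
    rw [Real.coe_toNNReal _ (by linarith)]
    have := t0 k
    nlinarith
  · intro k _
    have mW := hW.meas h
    have mW' := hW.meas (t k)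
    have : Measurable ((bmFirst W t B k).indicator (1 : Ω → ENNReal)) :=
      Measurable.indicator measurable_const (mS k)
    fun_prop

end

section
variable {Ω : Type*} [MeasurableSpace Ω] {P : Measure Ω} {W : ℝ → Ω → ℝ}

/-- The path hits level `A` almost surely. -/
lemma bm_hit (hW : IsBrownianMotion P W) (A : ℝ) :
    ∀ᵐ ω ∂P, ∃ t : ℝ, 0 ≤ t ∧ A ≤ |W t ω| := by
  have hbound : ∀ n : ℕ, P {ω | ¬ ∃ t : ℝ, 0 ≤ t ∧ A ≤ |W t ω|} ≤
      gaussianReal 0 1 (Metric.ball 0 (A / (n + 1))) := by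
    intro n
    have hn : (0:ℝ) < n + 1 := by positivity
    set T : ℝ := ((n:ℝ) + 1) ^ 2 with hT
    have hT0 : 0 ≤ T := by positivity
    have h1 := hW.incr 0 T le_rfl hT0
    have e : gaussianReal 0 (Real.toNNReal (T - 0)) =
        (gaussianReal 0 1).map (fun x => ((n:ℝ) + 1) * x) := by
      rw [gaussianReal_map_const_mul]
      congr 1
      · simp
      · ext; simp [hT0]; simp [hT]
    have hm : Measurable fun ω => W T ω - W 0 ω := (hW.meas T).sub (hW.meas 0)
    have h2 : P {ω | |W T ω| < A} = gaussianReal 0 1 (Metric.ball 0 (A / (n + 1))) := by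
      have h3 : P.map (fun ω => W T ω - W 0 ω) {x | |x| < A} = P {ω | |W T ω| < A} := by
        rw [Measure.map_apply hm (measurableSet_lt (by fun_prop) (by fun_prop))]
        simp [hW.start]
      rw [← h3, h1, e, Measure.map_apply (by fun_prop) (measurableSet_lt (by fun_prop) (by fun_prop))]
      congr 1
      ext x
      simp only [Set.mem_preimage, Set.mem_ofPred_eq, Metric.mem_ball, dist_zero_right,
        Real.norm_eq_abs, abs_mul, abs_of_pos hn]
      rw [lt_div_iff₀ hn, mul_comm]
    rw [← h2]
    refine measure_mono fun ω hω => ?_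
    simp only [Set.mem_ofPred_eq, not_exists, not_and, not_le] at hω ⊢
    exact hω T hT0
  have hlim : Filter.Tendsto (fun n : ℕ => gaussianReal 0 1 (Metric.closedBall 0 (|A| / (n + 1))))
      Filter.atTop (nhds (gaussianReal 0 1 (⋂ n : ℕ, Metric.closedBall 0 (|A| / (n + 1))))) := by
    refine tendsto_measure_iInter_atTop (fun n => measurableSet_closedBall.nullMeasurableSet) ?_
      ⟨0, measure_ne_top _ _⟩
    intro a b hab
    refine Metric.closedBall_subset_closedBall ?_
    gcongr
  have hz : gaussianReal 0 1 (⋂ n : ℕ, Metric.closedBall 0 (|A| / (n + 1))) = 0 := by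
    have := nullSingletonClass_gaussianReal (μ := 0) (v := 1) one_ne_zero
    refine measure_mono_null (t := {0}) ?_ (measure_singleton 0)
    intro x hx
    simp only [Set.mem_iInter, Metric.mem_closedBall, dist_zero_right, Real.norm_eq_abs] at hx
    have : Filter.Tendsto (fun n : ℕ => |A| / ((n:ℝ) + 1)) Filter.atTop (nhds 0) := by
      simpa [div_eq_mul_inv] using (tendsto_one_div_add_atTop_nhds_zero_nat (𝕜 := ℝ)).const_mul |A|
    have := ge_of_tendsto' this hx
    simpa using this
  rw [hz] at hlim
  rw [ae_iff]
  refine le_antisymm (ge_of_tendsto' hlim fun n => (hbound n).trans (measure_mono ?_)) (zero_le)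
  refine Metric.ball_subset_closedBall.trans (Metric.closedBall_subset_closedBall ?_)
  gcongr
  exact le_abs_self A

/-- grid -/
noncomputable def bmGrid (h : ℝ) (n k : ℕ) : ℝ := h * k / (n + 1)

lemma bmGrid_mono {h : ℝ} (hh : 0 < h) (n : ℕ) : Monotone (bmGrid h n) := by
  intro a b hab
  have : (a:ℝ) ≤ b := by exact_mod_cast hab
  unfold bmGrid
  gcongr

/-- Deterministic path fact. -/
lemma bm_path {w : ℝ → ℝ} (hw : Continuous w) {h A : ℝ} (hh : 0 < h)
    (hne : ∃ t, 0 ≤ t ∧ A ≤ |w t|) (hτ : sInf {t : ℝ | 0 ≤ t ∧ A ≤ |w t|} < h)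
    {B : ℕ → ℝ} (hBA : ∀ m, B m < A) (hB : Filter.Tendsto B Filter.atTop (nhds A))
    {δ : ℝ} (hδ : 0 < δ) :
    ∀ᶠ m in Filter.atTop, ∀ᶠ n : ℕ in Filter.atTop, ∃ k ∈ Finset.range (n + 1 + 1),
      (B m ≤ |w (bmGrid h n k)| ∧ ∀ j ∈ Finset.range k, |w (bmGrid h n j)| < B m) ∧
      |bmGrid h n k - sInf {t : ℝ | 0 ≤ t ∧ A ≤ |w t|}| < δ := by
  set S := {t : ℝ | 0 ≤ t ∧ A ≤ |w t|} with hS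
  set τ := sInf S with hτd
  have hbdd : BddBelow S := ⟨0, fun t ht => ht.1⟩
  have hclosed : IsClosed S := by
    have : S = Set.Ici 0 ∩ {t | A ≤ |w t|} := rfl
    rw [this]
    exact isClosed_Ici.inter (isClosed_le continuous_const hw.abs)
  have hmem : τ ∈ S := hclosed.csInf_mem hne hbdd
  have hbefore : ∀ t, 0 ≤ t → t < τ → |w t| < A := by
    intro t h0 ht
    by_contra hc
    exact absurd (csInf_le hbdd ⟨h0, not_lt.1 hc⟩) (not_le.2 ht)
  -- compact part
  have hcomp : ∀ᶠ m in Filter.atTop, ∀ t, 0 ≤ t → t ≤ τ - δ → |w t| < B m := by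
    rcases (Set.Icc 0 (τ - δ)).eq_empty_or_nonempty with he | he
    · refine Filter.Eventually.of_forall fun m t h0 h1 => ?_
      have : t ∈ Set.Icc 0 (τ - δ) := ⟨h0, h1⟩
      rw [he] at this; exact this.elim
    · obtain ⟨x, hx, hmax⟩ := isCompact_Icc.exists_isMaxOn he (hw.abs.continuousOn)
      have hxA := hbefore x hx.1 (by linarith [hx.2])
      filter_upwards [hB.eventually (lt_mem_nhds hxA)] with m hm t h0 h1
      exact (hmax ⟨h0, h1⟩).trans_lt hm
  filter_upwards [hcomp] with m hm
  have hnear : ∀ᶠ t in nhds τ, B m < |w t| :=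
    hw.abs.continuousAt.eventually (lt_mem_nhds ((hBA m).trans_le hmem.2))
  obtain ⟨η, hη, hη'⟩ := Metric.eventually_nhds_iff.1 hnear
  have hlim : Filter.Tendsto (fun n : ℕ => h / ((n:ℝ) + 1)) Filter.atTop (nhds 0) := by
    simpa [div_eq_mul_inv] using (tendsto_one_div_add_atTop_nhds_zero_nat (𝕜 := ℝ)).const_mul h
  filter_upwards [hlim.eventually (gt_mem_nhds (lt_min hη hδ))] with n hn
  have hn1 : h / ((n:ℝ) + 1) < η := hn.trans_le (min_le_left _ _)
  have hn2 : h / ((n:ℝ) + 1) < δ := hn.trans_le (min_le_right _ _)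
  have hnp : (0:ℝ) < n + 1 := by positivity
  set K := ⌈τ * (n + 1) / h⌉₊ with hK
  have hK1 : τ ≤ bmGrid h n K := by
    have := Nat.le_ceil (τ * (n + 1) / h)
    rw [div_le_iff₀ hh] at this
    rw [bmGrid, le_div_iff₀ hnp]
    linarith
  have hK2 : bmGrid h n K < τ + h / (n + 1) := by
    have := Nat.ceil_lt_add_one (a := τ * (n + 1) / h)
      (div_nonneg (mul_nonneg hmem.1 hnp.le) hh.le)
    have h2 : (K:ℝ) * h < (τ * (n + 1) / h + 1) * h := mul_lt_mul_of_pos_right this hh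
    have h3 : (τ * (n + 1) / h + 1) * h = τ * (n + 1) + h := by field_simp
    rw [bmGrid, div_lt_iff₀ hnp, add_mul, div_mul_cancel₀ _ hnp.ne']
    linarith
  have hK3 : K ≤ n + 1 := by
    refine Nat.ceil_le.2 ?_
    rw [div_le_iff₀ hh]
    push_cast
    nlinarith
  have hex : ∃ k, B m ≤ |w (bmGrid h n k)| := ⟨K, (hη' (by
    rw [Real.dist_eq, abs_lt]; constructor <;> linarith)).le⟩
  classical
  have hkK : Nat.find hex ≤ K := Nat.find_min' hex (hη' (by
    rw [Real.dist_eq, abs_lt]; constructor <;> linarith)).le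
  refine ⟨Nat.find hex, Finset.mem_range.2 (by omega), ⟨Nat.find_spec hex, fun j hj =>
    not_le.1 (Nat.find_min hex (Finset.mem_range.1 hj))⟩, ?_⟩
  have hle := bmGrid_mono hh n hkK
  have h0 : 0 ≤ bmGrid h n (Nat.find hex) := by unfold bmGrid; positivity
  have hspec := Nat.find_spec hex
  have : τ - δ < bmGrid h n (Nat.find hex) := by
    by_contra hc
    exact absurd (hm _ h0 (not_lt.1 hc)) (not_lt.2 hspec)
  rw [abs_lt]; constructor <;> linarith

end

/-- **Fourth-moment bound for the truncated Brownian increment.**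
For `h ∈ (0,1]`, `A_h := 4√(h log(1/h))`, and `τ` the first exit time of `W` from
`(−A_h, A_h)`, one has `E[(W_h − W_{h∧τ})⁴] ≤ 6 h^{10}`. -/
theorem truncated_brownian_increment_fourth_moment
    {Ω : Type*} [MeasurableSpace Ω] (P : Measure Ω) (W : ℝ → Ω → ℝ)
    (hW : IsBrownianMotion P W) (h : ℝ) (hh0 : 0 < h) (hh1 : h ≤ 1)
    (A : ℝ) (hA : A = 4 * Real.sqrt (h * Real.log (1 / h)))
    (τ : Ω → ℝ) (hτ : τ = fun ω => sInf {t : ℝ | 0 ≤ t ∧ A ≤ |W t ω|}) :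
    ∫⁻ ω, ENNReal.ofReal ((W h ω - W (min h (τ ω)) ω) ^ 4) ∂P
      ≤ ENNReal.ofReal (6 * h ^ 10) := by
  have hdet : ∀ x : ℝ, 0 ≤ x ^ 4 := fun x => by positivity
  rcases hh1.eq_or_lt with rfl | hlt
  · have hA0 : A = 0 := by simp [hA]
    have hτ0 : ∀ ω, τ ω = 0 := by
      intro ω
      rw [hτ, hA0]
      have : {t : ℝ | 0 ≤ t ∧ 0 ≤ |W t ω|} = Set.Ici 0 := by ext t; simp
      simp only [this, csInf_Ici]
    have := bm_gauss_fourth (Real.toNNReal (1 - 0))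
    rw [← hW.incr 0 1 le_rfl zero_le_one, lintegral_map (by fun_prop)
      (show Measurable fun ω => W 1 ω - W 0 ω from (hW.meas 1).sub (hW.meas 0))] at this
    simp only [hτ0, min_eq_right (zero_le_one (α := ℝ))]
    rw [this]
    refine ENNReal.ofReal_le_ofReal ?_
    norm_num
  have hlog : 0 < Real.log (1 / h) := Real.log_pos (by rw [lt_div_iff₀ hh0]; linarith)
  have hA0 : 0 < A := by rw [hA]; positivity
  have hA2 : A ^ 2 = 16 * (h * Real.log (1 / h)) := by
    rw [hA, mul_pow, Real.sq_sqrt (by positivity)]; norm_num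
  set B : ℕ → ℝ := fun m => A - A * (1 / ((m:ℝ) + 1)) with hBdef
  have hBA : ∀ m, B m < A := fun m => by
    have : 0 < A * (1 / ((m:ℝ) + 1)) := by positivity
    simp only [hBdef]; linarith
  have hB0 : ∀ m, 0 ≤ B m := fun m => by
    have h1 : (1 / ((m:ℝ) + 1)) ≤ 1 := by
      rw [div_le_one (by positivity)]; linarith [(Nat.cast_nonneg m : (0:ℝ) ≤ m)]
    have : A * (1 / ((m:ℝ) + 1)) ≤ A * 1 := mul_le_mul_of_nonneg_left h1 hA0.le
    simp only [hBdef]; linarith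
  have hBlim : Filter.Tendsto B Filter.atTop (nhds A) := by
    have := ((tendsto_one_div_add_atTop_nhds_zero_nat (𝕜 := ℝ)).const_mul A).const_sub A
    simpa [hBdef] using this
  set Y : ℕ → ℕ → Ω → ENNReal := fun m n ω =>
    ∑ k ∈ Finset.range (n + 1 + 1), ENNReal.ofReal ((W h ω - W (bmGrid h n k) ω) ^ 4) *
      (bmFirst W (bmGrid h n) (B m) k).indicator 1 ω with hY
  have hg0 : ∀ n, 0 ≤ bmGrid h n 0 := fun n => by simp [bmGrid]
  have hgn : ∀ n, bmGrid h n (n + 1) ≤ h := fun n => by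
    have : (0:ℝ) < n + 1 := by positivity
    rw [bmGrid]; push_cast; rw [mul_div_assoc, div_self this.ne', mul_one]
  have hYm : ∀ m n, Measurable (Y m n) := by
    intro m n
    refine Finset.measurable_fun_sum _ fun k _ => ?_
    have mW := hW.meas h
    have mW' := hW.meas (bmGrid h n k)
    have : Measurable ((bmFirst W (bmGrid h n) (B m) k).indicator (1 : Ω → ENNReal)) :=
      Measurable.indicator measurable_const
        (bmPast_le hW _ _ (bmFirst_meas W (bmGrid_mono hh0 n) (hg0 n) _ k))
    fun_prop
  have hYi : ∀ m n, ∫⁻ ω, Y m n ω ∂P ≤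
      ENNReal.ofReal (3 * h ^ 2 * (2 * Real.exp (- (B m ^ 2 / (2 * h))))) := fun m n =>
    bm_disc hW hh0 (hB0 m) (bmGrid_mono hh0 n) (hg0 n) (n + 1) (hgn n)
  have hpt : ∀ᵐ ω ∂P, ENNReal.ofReal ((W h ω - W (min h (τ ω)) ω) ^ 4) ≤
      Filter.liminf (fun m => Filter.liminf (fun n => Y m n ω) Filter.atTop) Filter.atTop := by
    filter_upwards [hW.cont, bm_hit hW A] with ω hc hne
    rcases le_or_gt h (τ ω) with hle | hlt'
    · simp [min_eq_left hle]
    rw [min_eq_right hlt'.le]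
    refine le_of_forall_lt fun c hcl => ?_
    obtain ⟨c', hcc', hc'⟩ := exists_between hcl
    refine hcc'.trans_le ?_
    have hcont : Continuous fun t => ENNReal.ofReal ((W h ω - W t ω) ^ 4) := by
      refine ENNReal.continuous_ofReal.comp ?_
      fun_prop
    obtain ⟨δ, hδ, hδ'⟩ := Metric.eventually_nhds_iff.1
      (hcont.continuousAt.eventually (lt_mem_nhds hc'))
    have hτω : τ ω = sInf {t : ℝ | 0 ≤ t ∧ A ≤ |W t ω|} := by rw [hτ]
    have hp := bm_path (w := fun t => W t ω) hc hh0 hne (by rw [← hτω]; exact hlt') hBA hBlim hδ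
    refine Filter.le_liminf_of_le (by isBoundedDefault) ?_
    filter_upwards [hp] with m hm
    refine Filter.le_liminf_of_le (by isBoundedDefault) ?_
    filter_upwards [hm] with n hn
    obtain ⟨k, hk, hfirst, hd⟩ := hn
    have h1 := hδ' (y := bmGrid h n k) (by rw [Real.dist_eq, hτω]; exact hd)
    refine h1.le.trans ?_
    refine le_trans ?_ (Finset.single_le_sum (f := fun k =>
      ENNReal.ofReal ((W h ω - W (bmGrid h n k) ω) ^ 4) *
      (bmFirst W (bmGrid h n) (B m) k).indicator 1 ω) (fun _ _ => zero_le) hk)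
    have hmem : ω ∈ bmFirst W (bmGrid h n) (B m) k := hfirst
    simp [Set.indicator_of_mem hmem]
  refine (lintegral_mono_ae hpt).trans ?_
  refine (lintegral_liminf_le fun m => Measurable.liminf (hYm m)).trans ?_
  have hlim : Filter.Tendsto (fun m =>
      ENNReal.ofReal (3 * h ^ 2 * (2 * Real.exp (- (B m ^ 2 / (2 * h)))))) Filter.atTop
      (nhds (ENNReal.ofReal (3 * h ^ 2 * (2 * Real.exp (- (A ^ 2 / (2 * h))))))) := by
    have hcf : Continuous fun x : ℝ =>
        ENNReal.ofReal (3 * h ^ 2 * (2 * Real.exp (- (x ^ 2 / (2 * h))))) := by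
      refine ENNReal.continuous_ofReal.comp ?_
      fun_prop
    exact (hcf.tendsto A).comp hBlim
  have hfin : 3 * h ^ 2 * (2 * Real.exp (- (A ^ 2 / (2 * h)))) = 6 * h ^ 10 := by
    have e1 : -(A ^ 2 / (2 * h)) = ((8:ℕ):ℝ) * Real.log h := by
      rw [hA2, one_div, Real.log_inv]; field_simp; norm_num; ring
    rw [e1, Real.exp_nat_mul, Real.exp_log hh0]; ring
  rw [hfin] at hlim
  rw [← hlim.liminf_eq]
  refine Filter.liminf_le_liminf (Filter.Eventually.of_forall fun m => ?_)
  refine (lintegral_liminf_le (hYm m)).trans ?_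
  refine (Filter.liminf_le_liminf (v := fun _ => ENNReal.ofReal
    (3 * h ^ 2 * (2 * Real.exp (- (B m ^ 2 / (2 * h)))))) (Filter.Eventually.of_forall (hYi m))).trans ?_
  simp
end

section
/- Uniform L^p moment bound for the monotone Euler–Maruyama scheme: Let b : ℝ → ℝ and σ : ℝ → [0,∞) be Lipschitz functions and x₀ ∈ ℝ. For every p > 1 there exists a constant C_p > 0, depending only on p, x₀, and the Lipschitz constants and values at 0 of b and σ, such that for every N ∈ ℕ, with h = 1/N, the monotone Euler–Maruyama scheme X^h satisfies E[ sup_{0 ≤ t ≤ 1} |X^h_t|^p ] ≤ C_p. -/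
open MeasureTheory ProbabilityTheory
open scoped NNReal

/-- The stopping time `τ_k`: the first time after `kh` at which the Brownian increment
`W_t − W_{kh}` leaves `(−A, A)`. -/
noncomputable def truncStop {Ω : Type*} (W : ℝ → Ω → ℝ) (h A : ℝ) (k : ℕ) (ω : Ω) : ℝ :=
  sInf {s : ℝ | k * h ≤ s ∧ A ≤ |W s ω - W (k * h) ω|}

/-- The piecewise-truncated Wiener process `W^h` with `N` steps of size `h = 1/N` and
truncation level `A_h = 4√(h log(1/h))`: `W^h_0 = 0` and, for `t ∈ (kh, (k+1)h]`,
`W^h_t = W^h_{kh} + W_{t ∧ τ_k} − W_{kh}`. -/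
noncomputable def truncWiener {Ω : Type*} (W : ℝ → Ω → ℝ) (N : ℕ) (t : ℝ) (ω : Ω) : ℝ :=
  let h : ℝ := 1 / N
  let A : ℝ := 4 * Real.sqrt (h * Real.log (1 / h))
  ∑ k ∈ Finset.range N,
    (W (min (min (max t (k * h)) ((k + 1) * h)) (truncStop W h A k ω)) ω - W (k * h) ω)

/-- The discrete-time monotone Euler–Maruyama scheme:
`X^h_0 = x₀` and `X^h_{(k+1)h} = X^h_{kh} + h b(X^h_{kh}) + σ(X^h_{kh})(W^h_{(k+1)h} − W^h_{kh})`. -/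
noncomputable def monEMdisc {Ω : Type*} (W : ℝ → Ω → ℝ) (N : ℕ) (b σ : ℝ → ℝ) (x₀ : ℝ) :
    ℕ → Ω → ℝ
  | 0 => fun _ => x₀
  | k + 1 => fun ω =>
      monEMdisc W N b σ x₀ k ω + (1 / N) * b (monEMdisc W N b σ x₀ k ω) +
        σ (monEMdisc W N b σ x₀ k ω) *
          (truncWiener W N ((k + 1) * (1 / N : ℝ)) ω - truncWiener W N (k * (1 / N : ℝ)) ω)

/-- The (continuous-time) monotone Euler–Maruyama scheme: `X^h_0 = x₀` and, for
`t ∈ (kh, (k+1)h]`,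
`X^h_t = X^h_{kh} + (t − kh) b(X^h_{kh}) + σ(X^h_{kh})(W^h_t − W^h_{kh})`. -/
noncomputable def monEM {Ω : Type*} (W : ℝ → Ω → ℝ) (N : ℕ) (b σ : ℝ → ℝ) (x₀ : ℝ)
    (t : ℝ) (ω : Ω) : ℝ :=
  if t ≤ 0 then x₀
  else
    let h : ℝ := 1 / N
    let k : ℕ := ⌈t * N⌉₊ - 1
    monEMdisc W N b σ x₀ k ω + (t - k * h) * b (monEMdisc W N b σ x₀ k ω) +
      σ (monEMdisc W N b σ x₀ k ω) * (truncWiener W N t ω - truncWiener W N (k * h) ω)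


set_option linter.unusedSectionVars false
set_option linter.unusedVariables false

def AL {Ω : Type*} [MeasurableSpace Ω] (P : Measure Ω) (f : Ω → ℝ) : Prop :=
  Measurable f ∧ ∀ n : ℕ, Integrable (fun ω => |f ω| ^ n) P

section ALsec
variable {Ω : Type*} [MeasurableSpace Ω] {P : Measure Ω} [IsProbabilityMeasure P]

lemma AL.intg {f : Ω → ℝ} (hf : AL P f) : Integrable f P := by
  have := hf.2 1
  simp only [pow_one] at this
  exact (integrable_norm_iff hf.1.aestronglyMeasurable).1 this

lemma AL.mono {f g : Ω → ℝ} (hf : AL P f) (hg : Measurable g) (h : ∀ ω, |g ω| ≤ |f ω|) :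
    AL P g := by
  refine ⟨hg, fun n => (hf.2 n).mono' ((hg.abs.pow_const n).aestronglyMeasurable) ?_⟩
  refine Filter.Eventually.of_forall fun ω => ?_
  rw [Real.norm_of_nonneg (by positivity)]
  exact pow_le_pow_left₀ (abs_nonneg _) (h ω) n

lemma AL.absf {f : Ω → ℝ} (hf : AL P f) : AL P (fun ω => |f ω|) := by
  refine ⟨hf.1.abs, fun n => ?_⟩
  simpa using hf.2 n

lemma AL.const (c : ℝ) : AL P (fun _ : Ω => c) :=
  ⟨measurable_const, fun n => integrable_const _⟩

lemma add_pow_le_two (a b : ℝ) (ha : 0 ≤ a) (hb : 0 ≤ b) (n : ℕ) :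
    (a + b) ^ n ≤ 2 ^ n * (a ^ n + b ^ n) := by
  rcases le_total a b with h | h
  · calc (a + b) ^ n ≤ (2 * b) ^ n := by gcongr; linarith
      _ = 2 ^ n * b ^ n := mul_pow ..
      _ ≤ _ := by gcongr; have : 0 ≤ a ^ n := by positivity
                  linarith
  · calc (a + b) ^ n ≤ (2 * a) ^ n := by gcongr; linarith
      _ = 2 ^ n * a ^ n := mul_pow ..
      _ ≤ _ := by gcongr; have : 0 ≤ b ^ n := by positivity
                  linarith

lemma AL.add {f g : Ω → ℝ} (hf : AL P f) (hg : AL P g) : AL P (fun ω => f ω + g ω) := by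
  refine ⟨hf.1.add hg.1, fun n => ?_⟩
  refine (((hf.2 n).add (hg.2 n)).const_mul (2 ^ n)).mono'
    (((hf.1.add hg.1).abs.pow_const n).aestronglyMeasurable) ?_
  refine Filter.Eventually.of_forall fun ω => ?_
  rw [Real.norm_of_nonneg (by positivity)]
  exact (pow_le_pow_left₀ (abs_nonneg _) (abs_add_le _ _) n).trans
    (add_pow_le_two _ _ (abs_nonneg _) (abs_nonneg _) n)

lemma AL.mul {f g : Ω → ℝ} (hf : AL P f) (hg : AL P g) : AL P (fun ω => f ω * g ω) := by
  refine ⟨hf.1.mul hg.1, fun n => ?_⟩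
  refine ((hf.2 (n * 2)).add (hg.2 (n * 2))).mono'
    (((hf.1.mul hg.1).abs.pow_const n).aestronglyMeasurable) ?_
  refine Filter.Eventually.of_forall fun ω => ?_
  rw [Real.norm_of_nonneg (by positivity)]
  simp only [Pi.add_apply, pow_mul, abs_mul, mul_pow]
  have h1 : 0 ≤ |f ω| ^ n := by positivity
  have h2 : 0 ≤ |g ω| ^ n := by positivity
  nlinarith [sq_nonneg (|f ω| ^ n - |g ω| ^ n)]

lemma AL.powr {f : Ω → ℝ} (hf : AL P f) (n : ℕ) : AL P (fun ω => f ω ^ n) := by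
  induction n with
  | zero => simpa using AL.const (P := P) 1
  | succ k ih => simpa only [pow_succ] using ih.mul hf

lemma AL.maxf {f g : Ω → ℝ} (hf : AL P f) (hg : AL P g) : AL P (fun ω => max (f ω) (g ω)) := by
  refine (hf.absf.add hg.absf).mono (hf.1.max hg.1) fun ω => ?_
  rw [abs_of_nonneg (a := |f ω| + |g ω|) (by positivity)]
  rcases max_choice (f ω) (g ω) with h | h <;> rw [h] <;>
    linarith [abs_nonneg (f ω), abs_nonneg (g ω)]

end ALsec

/-- Gaussian constant. -/
noncomputable def gG (n : ℕ) : ℝ := ∫ z, (2 + |z|) ^ n * (1 + |z|) ^ 2 ∂(gaussianReal 0 1)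

lemma AL_id_gaussian (v : ℝ≥0) : AL (gaussianReal 0 v) (fun x => x) := by
  refine ⟨measurable_id, fun n => ?_⟩
  rcases Nat.eq_zero_or_pos n with rfl | hn
  · simp
  · have := (memLp_id_gaussianReal (μ := 0) (v := v) (n : ℝ≥0))
    exact MemLp.integrable_norm_pow (f := fun x : ℝ => x) (p := n) (by have h := this; simp only [ENNReal.coe_natCast] at h; exact h) hn.ne'

lemma gG_nonneg (n : ℕ) : 0 ≤ gG n := by
  unfold gG; exact integral_nonneg fun z => by positivity

lemma gauss_scale (d : ℝ) (hd : 0 ≤ d) :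
    gaussianReal 0 d.toNNReal = (gaussianReal 0 1).map (fun x => √d * x) := by
  rw [gaussianReal_map_const_mul]
  congr 1
  · simp
  · ext; simp [Real.sq_sqrt hd, hd]

lemma gauss_bound (n : ℕ) (d : ℝ) (hd : 0 ≤ d) (hd1 : d ≤ 1) :
    ∫ z, (1 + (d + |z|)) ^ n * (d + |z|) ^ 2 ∂(gaussianReal 0 d.toNNReal) ≤ d * gG n := by
  rw [gauss_scale d hd, integral_map (by fun_prop) (by fun_prop), gG, ← integral_const_mul]
  have hA := AL_id_gaussian 1
  have hc := fun c : ℝ => AL.const (P := gaussianReal 0 1) c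
  have hs0 : 0 ≤ √d := Real.sqrt_nonneg d
  have hs1 : √d ≤ 1 := Real.sqrt_le_one.2 hd1
  have hss : √d * √d = d := Real.mul_self_sqrt hd
  refine integral_mono ?_ ?_ fun z => ?_
  · have h1 := (hc d).add ((hc √d).mul hA).absf
    exact ((((hc 1).add h1).powr n).mul (h1.powr 2)).intg
  · have h1 := hA.absf
    exact ((hc d).mul ((((hc 2).add h1).powr n).mul (((hc 1).add h1).powr 2))).intg
  · have hz := abs_nonneg z
    simp only [abs_mul, abs_of_nonneg hs0]
    have h1 : d + √d * |z| ≤ √d * (1 + |z|) := by nlinarith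
    have h2 : 1 + (d + √d * |z|) ≤ 2 + |z| := by nlinarith
    calc (1 + (d + √d * |z|)) ^ n * (d + √d * |z|) ^ 2
        ≤ (2 + |z|) ^ n * (√d * (1 + |z|)) ^ 2 := by gcongr
      _ = d * ((2 + |z|) ^ n * (1 + |z|) ^ 2) := by
          rw [mul_pow, Real.sq_sqrt hd]; ring

section step
variable {Ω : Type*} {m0 : MeasurableSpace Ω} [mΩ : MeasurableSpace Ω] {P : Measure Ω}
  [IsProbabilityMeasure P]

lemma indep_int (hm : m0 ≤ mΩ) {Δ : Ω → ℝ} (hΔ : Measurable Δ)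
    (hind : Indep (MeasurableSpace.comap Δ inferInstance) m0 P) {g : Ω → ℝ}
    (hg : Measurable[m0] g) {φ : ℝ → ℝ} (hφ : Measurable φ) :
    ∫ ω, g ω * φ (Δ ω) ∂P = (∫ ω, g ω ∂P) * ∫ ω, φ (Δ ω) ∂P := by
  refine IndepFun.integral_fun_mul_eq_mul_integral ?_ (hg.mono hm le_rfl).aestronglyMeasurable
    (hφ.comp hΔ).aestronglyMeasurable
  rw [IndepFun_iff_Indep]
  refine indep_of_indep_of_le_left (indep_of_indep_of_le_right hind.symm ?_) hg.comap_le
  rw [show (fun ω => φ (Δ ω)) = φ ∘ Δ from rfl, ← MeasurableSpace.comap_comp]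
  exact MeasurableSpace.comap_mono hφ.comap_le

lemma indep_zero (hm : m0 ≤ mΩ) {Δ : Ω → ℝ} (hΔ : Measurable Δ)
    (hind : Indep (MeasurableSpace.comap Δ inferInstance) m0 P) {d : ℝ}
    (hlaw : P.map Δ = gaussianReal 0 d.toNNReal) {g : Ω → ℝ}
    (hg : Measurable[m0] g) : ∫ ω, g ω * Δ ω ∂P = 0 := by
  have h := indep_int hm hΔ hind hg (φ := fun x => x) measurable_id
  have h2 : ∫ ω, Δ ω ∂P = 0 := by
    have := integral_map (μ := P) hΔ.aemeasurable (f := fun x : ℝ => x) (by fun_prop)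
    rw [hlaw, integral_id_gaussianReal] at this
    exact this.symm
  rw [h, h2, mul_zero]

lemma indep_bound (hm : m0 ≤ mΩ) {Δ : Ω → ℝ} (hΔ : Measurable Δ)
    (hind : Indep (MeasurableSpace.comap Δ inferInstance) m0 P) {d : ℝ} (hd : 0 ≤ d) (hd1 : d ≤ 1)
    (hlaw : P.map Δ = gaussianReal 0 d.toNNReal) {g : Ω → ℝ}
    (hg : Measurable[m0] g) (hg0 : ∀ ω, 0 ≤ g ω) (n : ℕ) :
    ∫ ω, g ω * ((1 + (d + |Δ ω|)) ^ n * (d + |Δ ω|) ^ 2) ∂P ≤ d * gG n * ∫ ω, g ω ∂P := by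
  have h := indep_int hm hΔ hind hg (φ := fun z => (1 + (d + |z|)) ^ n * (d + |z|) ^ 2)
    (by fun_prop)
  have h2 := integral_map (μ := P) hΔ.aemeasurable
    (f := fun z : ℝ => (1 + (d + |z|)) ^ n * (d + |z|) ^ 2) (by fun_prop)
  rw [hlaw] at h2
  rw [h, ← h2, mul_comm]
  exact mul_le_mul_of_nonneg_right (gauss_bound n d hd hd1) (integral_nonneg hg0)

lemma AL_of_law {Δ : Ω → ℝ} (hΔ : Measurable Δ) {v : ℝ≥0}
    (hlaw : P.map Δ = gaussianReal 0 v) : AL P Δ := by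
  refine ⟨hΔ, fun n => ?_⟩
  have := (AL_id_gaussian v).2 n
  rw [← hlaw] at this
  exact this.comp_measurable hΔ

lemma taylor (a y : ℝ) (n : ℕ) :
    |(a + y) ^ (n + 2) - a ^ (n + 2) - (n + 2) * a ^ (n + 1) * y|
      ≤ (n + 2) ^ 2 * ((|a| + |y|) ^ n * y ^ 2) := by
  induction n with
  | zero =>
    simp only [Nat.cast_zero, pow_zero]
    rw [show (a + y) ^ (0 + 2) - a ^ (0 + 2) - (0 + 2) * a ^ (0 + 1) * y = y ^ 2 by ring,
      abs_of_nonneg (sq_nonneg y)]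
    nlinarith [sq_nonneg y]
  | succ n ih =>
    have key : (a + y) ^ (n + 1 + 2) - a ^ (n + 1 + 2) - ((n + 1 : ℕ) + 2) * a ^ (n + 1 + 1) * y
      = (a + y) * ((a + y) ^ (n + 2) - a ^ (n + 2) - (n + 2) * a ^ (n + 1) * y)
        + (n + 2) * a ^ (n + 1) * y ^ 2 := by push_cast; ring
    rw [key]
    set R := (a + y) ^ (n + 2) - a ^ (n + 2) - (n + 2) * a ^ (n + 1) * y
    have h1 : |a + y| ≤ |a| + |y| := abs_add_le _ _
    have hc : (0 : ℝ) ≤ n := Nat.cast_nonneg n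
    calc |(a + y) * R + (n + 2) * a ^ (n + 1) * y ^ 2|
        ≤ |a + y| * |R| + (n + 2) * |a| ^ (n + 1) * y ^ 2 := by
          refine (abs_add_le _ _).trans ?_
          rw [abs_mul, abs_mul, abs_mul, abs_pow, abs_of_nonneg (sq_nonneg y),
            abs_of_nonneg (by positivity : (0 : ℝ) ≤ n + 2)]
      _ ≤ (|a| + |y|) * ((n + 2) ^ 2 * ((|a| + |y|) ^ n * y ^ 2))
          + (n + 2) * (|a| + |y|) ^ (n + 1) * y ^ 2 := by
          gcongr; linarith [abs_nonneg y]
      _ = ((n + 2) ^ 2 + (n + 2)) * ((|a| + |y|) ^ (n + 1) * y ^ 2) := by ring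
      _ ≤ ((n + 1 : ℕ) + 2) ^ 2 * ((|a| + |y|) ^ (n + 1) * y ^ 2) := by
          gcongr; push_cast; nlinarith

lemma even_tangent (a y : ℝ) (m : ℕ) (hm : Even m) :
    a ^ m + m * a ^ (m - 1) * y ≤ (a + y) ^ m := by
  have hc := hm.convexOn_pow (𝕜 := ℝ)
  have hd : HasDerivAt (fun x : ℝ => x ^ m) (m * a ^ (m - 1)) a := by simpa using hasDerivAt_pow m a
  rcases lt_trichotomy y 0 with h | h | h
  · have := hc.slope_le_of_hasDerivAt (x := a + y) (y := a) trivial trivial (by linarith) hd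
    rw [slope_def_field, div_le_iff₀ (by linarith)] at this
    linarith
  · simp [h]
  · have := hc.le_slope_of_hasDerivAt (x := a) (y := a + y) trivial trivial (by linarith) hd
    rw [slope_def_field, le_div_iff₀ (by linarith)] at this
    linarith

/-- One step moment estimate. -/
lemma step_moment (hm : m0 ≤ mΩ) {Δ X β θ : Ω → ℝ} (hΔ : Measurable Δ)
    (hind : Indep (MeasurableSpace.comap Δ inferInstance) m0 P) {d : ℝ} (hd : 0 ≤ d) (hd1 : d ≤ 1)
    (hlaw : P.map Δ = gaussianReal 0 d.toNNReal)
    (hX : Measurable[m0] X) (hβ : Measurable[m0] β) (hθ : Measurable[m0] θ)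
    (aX : AL P X) (aβ : AL P β) (aθ : AL P θ) (n : ℕ) :
    ∫ ω, (X ω + d * β ω + θ ω * Δ ω) ^ (n + 2) ∂P ≤ ∫ ω, X ω ^ (n + 2) ∂P +
      d * ((n + 2) + (n + 2) ^ 2 * gG n) * ∫ ω, (|X ω| + |β ω| + |θ ω|) ^ (n + 2) ∂P := by
  have aΔ := AL_of_law hΔ hlaw
  have hc := fun c : ℝ => AL.const (P := P) c
  set B : Ω → ℝ := fun ω => |X ω| + |β ω| + |θ ω| with hB
  have aB : AL P B := (aX.absf.add aβ.absf).add aθ.absf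
  have hBm : Measurable[m0] B := by
    have h1 : Measurable[m0] fun ω => |X ω| := continuous_abs.measurable.comp hX
    have h2 : Measurable[m0] fun ω => |β ω| := continuous_abs.measurable.comp hβ
    have h3 : Measurable[m0] fun ω => |θ ω| := continuous_abs.measurable.comp hθ
    exact (h1.add h2).add h3
  have hB0 : ∀ ω, 0 ≤ B ω := fun ω => by simp only [hB]; positivity
  set U : Ω → ℝ := fun ω => (1 + (d + |Δ ω|)) ^ n * (d + |Δ ω|) ^ 2 with hU
  have aD : AL P (fun ω => d + |Δ ω|) := (hc d).add aΔ.absf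
  have aU : AL P U := (((hc 1).add aD).powr n).mul (aD.powr 2)
  have key : ∀ ω, (X ω + d * β ω + θ ω * Δ ω) ^ (n + 2) ≤
      ((X ω ^ (n + 2) + d * (n + 2) * B ω ^ (n + 2)) + (n + 2) * (X ω ^ (n + 1) * θ ω * Δ ω))
        + (n + 2) ^ 2 * (B ω ^ (n + 2) * U ω) := by
    intro ω
    have ht := (abs_le.1 (taylor (X ω) (d * β ω + θ ω * Δ ω) n)).2
    have hXB : |X ω| ≤ B ω := by simp only [hB]; linarith [abs_nonneg (β ω), abs_nonneg (θ ω)]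
    have hβB : |β ω| ≤ B ω := by simp only [hB]; linarith [abs_nonneg (X ω), abs_nonneg (θ ω)]
    have hθB : |θ ω| ≤ B ω := by simp only [hB]; linarith [abs_nonneg (X ω), abs_nonneg (β ω)]
    have hb := hB0 ω
    have hy : |d * β ω + θ ω * Δ ω| ≤ B ω * (d + |Δ ω|) := by
      refine (abs_add_le _ _).trans ?_
      rw [abs_mul, abs_mul, abs_of_nonneg hd]
      have := mul_le_mul_of_nonneg_left hβB hd
      have := mul_le_mul_of_nonneg_right hθB (abs_nonneg (Δ ω))
      linarith
    have h1 : ((n : ℝ) + 2) ^ 2 * ((|X ω| + |d * β ω + θ ω * Δ ω|) ^ n *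
        (d * β ω + θ ω * Δ ω) ^ 2) ≤ (n + 2) ^ 2 * (B ω ^ (n + 2) * U ω) := by
      have : (|X ω| + |d * β ω + θ ω * Δ ω|) ^ n * (d * β ω + θ ω * Δ ω) ^ 2
          ≤ (B ω * (1 + (d + |Δ ω|))) ^ n * (B ω * (d + |Δ ω|)) ^ 2 := by
        rw [← sq_abs (d * β ω + θ ω * Δ ω)]
        gcongr
        linarith
      refine mul_le_mul_of_nonneg_left (this.trans (le_of_eq ?_)) (by positivity)
      simp only [hU, mul_pow]; ring
    have h2 : X ω ^ (n + 1) * β ω ≤ B ω ^ (n + 2) := by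
      refine (le_abs_self _).trans ?_
      rw [abs_mul, abs_pow, pow_succ (B ω) (n + 1)]
      gcongr
    have h3 := mul_le_mul_of_nonneg_left h2 (by positivity : 0 ≤ d * ((n : ℝ) + 2))
    have : X ω + d * β ω + θ ω * Δ ω = X ω + (d * β ω + θ ω * Δ ω) := by ring
    rw [this]
    linarith
  have aBn := aB.powr (n + 2)
  have e1 := (aX.powr (n + 2)).add (((hc (d * (n + 2)))).mul aBn)
  have e2 := (hc (n + 2)).mul (((aX.powr (n + 1)).mul aθ).mul aΔ)
  have e3 := (hc ((n + 2) ^ 2)).mul (aBn.mul aU)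
  have hXm1 : Measurable[m0] fun ω => X ω ^ (n + 1) * θ ω := (hX.pow_const (n + 1)).mul hθ
  have z := indep_zero hm hΔ hind hlaw hXm1
  have w := indep_bound hm hΔ hind hd hd1 hlaw (hBm.pow_const (n + 2))
    (fun ω => pow_nonneg (hB0 ω) _) n
  have e0 := ((aX.add ((hc d).mul aβ)).add (aθ.mul aΔ)).powr (n + 2)
  refine (integral_mono e0.intg ((e1.add e2).add e3).intg key).trans ?_
  rw [integral_add (e1.add e2).intg e3.intg, integral_add e1.intg e2.intg,
    integral_add (aX.powr (n + 2)).intg (((hc (d * (n + 2)))).mul aBn).intg,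
    integral_const_mul, integral_const_mul, integral_const_mul, z]
  have := mul_le_mul_of_nonneg_left w (by positivity : 0 ≤ ((n : ℝ) + 2) ^ 2)
  simp only [hU]
  nlinarith

end step


noncomputable def rmax (s : ℕ → ℝ) : ℕ → ℝ
  | 0 => s 0
  | n + 1 => max (rmax s n) (s (n + 1))

lemma le_rmax (s : ℕ → ℝ) {i n : ℕ} (h : i ≤ n) : s i ≤ rmax s n := by
  induction n with
  | zero => simp at h; subst h; exact le_rfl
  | succ n ih =>
    rcases Nat.lt_or_ge n i with h1 | h1
    · have : i = n + 1 := by omega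
      subst this; exact le_max_right _ _
    · exact (ih h1).trans (le_max_left _ _)

lemma rmax_mono (s : ℕ → ℝ) : Monotone (rmax s) :=
  monotone_nat_of_le_succ fun n => le_max_left _ _

lemma doob_path (s : ℕ → ℝ) (n : ℕ) :
    (rmax s n) ^ 2 ≤ 4 * (s n) ^ 2 - 4 * ∑ i ∈ Finset.range n, rmax s i * (s (i + 1) - s i) := by
  have key : (rmax s n) ^ 2 / 2 ≤ rmax s n * s n -
      ∑ i ∈ Finset.range n, rmax s i * (s (i + 1) - s i) := by
    induction n with
    | zero => simp [rmax]; nlinarith [sq_nonneg (s 0)]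
    | succ n ih =>
      rw [Finset.sum_range_succ]
      simp only [rmax]
      rcases le_total (s (n + 1)) (rmax s n) with h | h
      · rw [max_eq_left h]; linarith
      · rw [max_eq_right h]; nlinarith [sq_nonneg (s (n + 1) - rmax s n)]
  nlinarith [sq_nonneg (rmax s n - 2 * s n)]

lemma gronwall_disc (u : ℕ → ℝ) (κ : ℕ → ℕ) (hκ : ∀ j, κ j ≤ j) (c : ℝ) (hc : 0 ≤ c)
    (hu : ∀ j, 0 ≤ u j) (hstep : ∀ j, u (j + 1) ≤ u j + c * (1 + u j + u (κ j))) (j : ℕ) :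
    ∀ i ≤ j, 1 + u i ≤ (1 + 2 * c) ^ j * (1 + u 0) := by
  induction j with
  | zero => intro i hi; simp at hi; subst hi; simp
  | succ j ih =>
    intro i hi
    have hmon : (1 + 2 * c) ^ j * (1 + u 0) ≤ (1 + 2 * c) ^ (j + 1) * (1 + u 0) := by
      have := hu 0
      gcongr
      · linarith
      · omega
    rcases Nat.lt_or_ge i (j + 1) with h | h
    · exact (ih i (by omega)).trans hmon
    · have : i = j + 1 := by omega
      subst this
      have h1 := ih j le_rfl
      have h2 := ih (κ j) (hκ j)
      have h3 := hstep j
      rw [pow_succ]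
      nlinarith [mul_le_mul_of_nonneg_left h1 hc, mul_le_mul_of_nonneg_left h2 hc]

structure DiscSys {Ω : Type*} [mΩ : MeasurableSpace Ω] (P : Measure Ω) (J : ℕ) (K x0 : ℝ)
    (F : ℕ → MeasurableSpace Ω) (κ : ℕ → ℕ) (X β θ Δ : ℕ → Ω → ℝ) : Prop where
  J_pos : 0 < J
  K_nonneg : 0 ≤ K
  F_le : ∀ j, F j ≤ mΩ
  κ_le : ∀ j, κ j ≤ j
  Xm : ∀ i j, i ≤ j → Measurable[F j] (X i)
  βm : ∀ j, Measurable[F j] (β j)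
  θm : ∀ j, Measurable[F j] (θ j)
  Δm : ∀ j, Measurable (Δ j)
  law : ∀ j, P.map (Δ j) = gaussianReal 0 (1 / (J : ℝ)).toNNReal
  ind : ∀ j, Indep (MeasurableSpace.comap (Δ j) inferInstance) (F j) P
  βb : ∀ j ω, |β j ω| ≤ K * (1 + |X (κ j) ω|)
  θb : ∀ j ω, |θ j ω| ≤ K * (1 + |X (κ j) ω|)
  X0 : ∀ ω, X 0 ω = x0
  Xs : ∀ j ω, X (j + 1) ω = X j ω + 1 / (J : ℝ) * β j ω + θ j ω * Δ j ω

noncomputable def cB (K : ℝ) (q : ℕ) : ℝ := (1 + 2 * K) ^ q * 3 ^ q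

noncomputable def mB (K x0 : ℝ) (n : ℕ) : ℝ :=
  Real.exp (2 * (((n + 2) + (n + 2) ^ 2 * gG n) * cB K (n + 2))) * (1 + x0 ^ (n + 2))

noncomputable def xB (K x0 : ℝ) (n : ℕ) : ℝ :=
  8 * mB K x0 (2 * n + 2) +
    16 * (n + 2) ^ 2 * (cB K (2 * n + 4) * (1 + mB K x0 (2 * n + 2) + mB K x0 (2 * n + 2)))

lemma three_pow (a b : ℝ) (ha : 0 ≤ a) (hb : 0 ≤ b) (q : ℕ) :
    (1 + a + b) ^ q ≤ 3 ^ q * (1 + a ^ q + b ^ q) := by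
  have hA : 0 ≤ a ^ q := by positivity
  have hB : 0 ≤ b ^ q := by positivity
  have : ∀ m, 0 ≤ m → 1 + a + b ≤ 3 * m → m ^ q ≤ 1 + a ^ q + b ^ q →
      (1 + a + b) ^ q ≤ 3 ^ q * (1 + a ^ q + b ^ q) := by
    intro m hm h1 h2
    calc (1 + a + b) ^ q ≤ (3 * m) ^ q := by gcongr
      _ = 3 ^ q * m ^ q := mul_pow ..
      _ ≤ _ := by gcongr
  rcases le_total a b with h | h
  · rcases le_total 1 b with h' | h'
    · exact this b hb (by linarith) (by linarith)
    · exact this 1 (by norm_num) (by linarith) (by simp; linarith)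
  · rcases le_total 1 a with h' | h'
    · exact this a ha (by linarith) (by linarith)
    · exact this 1 (by norm_num) (by linarith) (by simp; linarith)

namespace DiscSys
variable {Ω : Type*} [mΩ : MeasurableSpace Ω] {P : Measure Ω} [IsProbabilityMeasure P]
  {J : ℕ} {K x0 : ℝ} {F : ℕ → MeasurableSpace Ω} {κ : ℕ → ℕ} {X β θ Δ : ℕ → Ω → ℝ}

lemma cB_nonneg (hS : DiscSys P J K x0 F κ X β θ Δ) (q : ℕ) : 0 ≤ cB K q := by
  have := hS.K_nonneg
  unfold cB; positivity

lemma alAll (hS : DiscSys P J K x0 F κ X β θ Δ) (j : ℕ) :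
    ∀ i ≤ j, AL P (X i) := by
  induction j with
  | zero =>
    intro i hi; simp at hi; subst hi
    rw [show X 0 = fun _ => x0 from funext hS.X0]; exact AL.const _
  | succ j ih =>
    intro i hi
    rcases Nat.lt_or_ge i (j + 1) with h | h
    · exact ih i (by omega)
    · have : i = j + 1 := by omega
      subst this
      have aΔ := AL_of_law (hS.Δm j) (hS.law j)
      have hc := fun c : ℝ => AL.const (P := P) c
      have aD : AL P (fun ω => K * (1 + |X (κ j) ω|)) :=
        (hc K).mul ((hc 1).add (ih _ (hS.κ_le j)).absf)
      have aβ : AL P (β j) := aD.mono ((hS.βm j).mono (hS.F_le j) le_rfl)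
        fun ω => (hS.βb j ω).trans (le_abs_self _)
      have aθ : AL P (θ j) := aD.mono ((hS.θm j).mono (hS.F_le j) le_rfl)
        fun ω => (hS.θb j ω).trans (le_abs_self _)
      rw [show X (j + 1) = _ from funext (hS.Xs j)]
      exact ((ih j le_rfl).add ((hc _).mul aβ)).add (aθ.mul aΔ)

lemma alX (hS : DiscSys P J K x0 F κ X β θ Δ) (j : ℕ) : AL P (X j) := hS.alAll j j le_rfl

lemma alβ (hS : DiscSys P J K x0 F κ X β θ Δ) (j : ℕ) : AL P (β j) :=
  ((AL.const (P := P) K).mul ((AL.const 1).add (hS.alX (κ j)).absf)).mono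
    ((hS.βm j).mono (hS.F_le j) le_rfl) fun ω => (hS.βb j ω).trans (le_abs_self _)

lemma alθ (hS : DiscSys P J K x0 F κ X β θ Δ) (j : ℕ) : AL P (θ j) :=
  ((AL.const (P := P) K).mul ((AL.const 1).add (hS.alX (κ j)).absf)).mono
    ((hS.θm j).mono (hS.F_le j) le_rfl) fun ω => (hS.θb j ω).trans (le_abs_self _)

lemma alB (hS : DiscSys P J K x0 F κ X β θ Δ) (j : ℕ) :
    AL P (fun ω => |X j ω| + |β j ω| + |θ j ω|) :=
  ((hS.alX j).absf.add (hS.alβ j).absf).add (hS.alθ j).absf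

lemma B_moment (hS : DiscSys P J K x0 F κ X β θ Δ) (j q : ℕ) (hq : Even q) :
    ∫ ω, (|X j ω| + |β j ω| + |θ j ω|) ^ q ∂P ≤
      cB K q * (1 + ∫ ω, X j ω ^ q ∂P + ∫ ω, X (κ j) ω ^ q ∂P) := by
  have a1 := (hS.alX j).powr q
  have a2 := (hS.alX (κ j)).powr q
  have hc := fun c : ℝ => AL.const (P := P) c
  have key : ∀ ω, (|X j ω| + |β j ω| + |θ j ω|) ^ q ≤
      cB K q * (1 + X j ω ^ q + X (κ j) ω ^ q) := by
    intro ω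
    have h1 := hS.βb j ω
    have h2 := hS.θb j ω
    have hK := hS.K_nonneg
    have hx := abs_nonneg (X j ω)
    have hy := abs_nonneg (X (κ j) ω)
    have : |X j ω| + |β j ω| + |θ j ω| ≤ (1 + 2 * K) * (1 + |X j ω| + |X (κ j) ω|) := by
      nlinarith [mul_nonneg hK hx]
    calc _ ≤ ((1 + 2 * K) * (1 + |X j ω| + |X (κ j) ω|)) ^ q := by gcongr
      _ = (1 + 2 * K) ^ q * (1 + |X j ω| + |X (κ j) ω|) ^ q := mul_pow ..
      _ ≤ (1 + 2 * K) ^ q * (3 ^ q * (1 + |X j ω| ^ q + |X (κ j) ω| ^ q)) := by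
        gcongr; exact three_pow _ _ hx hy q
      _ = _ := by rw [hq.pow_abs, hq.pow_abs, cB]; ring
  refine (integral_mono ((hS.alB j).powr q).intg
    ((hc _).mul (((hc 1).add a1).add a2)).intg key).trans (le_of_eq ?_)
  rw [integral_const_mul, integral_add ((hc 1).add a1).intg a2.intg,
    integral_add (hc 1).intg a1.intg]
  simp

lemma dJ (hS : DiscSys P J K x0 F κ X β θ Δ) : 0 ≤ 1 / (J : ℝ) ∧ 1 / (J : ℝ) ≤ 1 := by
  have : (1 : ℝ) ≤ J := by exact_mod_cast hS.J_pos
  exact ⟨by positivity, by rw [div_le_one (by linarith)]; exact this⟩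

lemma moment (hS : DiscSys P J K x0 F κ X β θ Δ) (n : ℕ) (hn : Even n) (j : ℕ) (hj : j ≤ J) :
    ∫ ω, X j ω ^ (n + 2) ∂P ≤ mB K x0 n := by
  have hq : Even (n + 2) := hn.add even_two
  set D := ((n + 2 : ℝ) + (n + 2) ^ 2 * gG n) * cB K (n + 2) with hD
  have hg := gG_nonneg n
  have hcB := hS.cB_nonneg (n + 2)
  have hD0 : 0 ≤ D := by positivity
  have hJ := hS.dJ
  have hJ' : (0 : ℝ) < J := by exact_mod_cast hS.J_pos
  have hG := gronwall_disc (fun j => ∫ ω, X j ω ^ (n + 2) ∂P) κ hS.κ_le (1 / J * D)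
    (mul_nonneg hJ.1 hD0) (fun j => integral_nonneg fun ω => hq.pow_nonneg _) (fun j => by
      have h := step_moment (hS.F_le j) (hS.Δm j) (hS.ind j) hJ.1 hJ.2 (hS.law j)
        (hS.Xm j j le_rfl) (hS.βm j) (hS.θm j) (hS.alX j) (hS.alβ j) (hS.alθ j) n
      simp only [← hS.Xs] at h
      refine h.trans ?_
      have h2 := mul_le_mul_of_nonneg_left (hS.B_moment j (n + 2) hq)
        (by have := hJ.1; positivity : 0 ≤ 1 / (J : ℝ) * ((n + 2) + (n + 2) ^ 2 * gG n))
      refine (add_le_add_right h2 _).trans (le_of_eq ?_)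
      rw [hD]; ring) J j hj
  have h0 : ∫ ω, X 0 ω ^ (n + 2) ∂P = x0 ^ (n + 2) := by simp [hS.X0]
  simp only [h0] at hG
  have h1 : (1 + 2 * (1 / (J : ℝ) * D)) ^ J ≤ Real.exp (2 * D) := by
    calc (1 + 2 * (1 / (J : ℝ) * D)) ^ J ≤ (Real.exp (2 * (1 / (J : ℝ) * D))) ^ J := by
          have := hJ.1
          gcongr
          linarith [Real.add_one_le_exp (2 * (1 / (J : ℝ) * D))]
      _ = Real.exp (2 * D) := by
          rw [← Real.exp_nat_mul]; congr 1; field_simp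
  have h2 : (0 : ℝ) ≤ 1 + x0 ^ (n + 2) := by have := hq.pow_nonneg x0; linarith
  have := mul_le_mul_of_nonneg_right h1 h2
  unfold mB
  rw [← hD]
  linarith

lemma al_rmax (hS : DiscSys P J K x0 F κ X β θ Δ) (q j : ℕ) :
    AL P (fun ω => rmax (fun i => X i ω ^ q) j) := by
  induction j with
  | zero => exact (hS.alX 0).powr q
  | succ j ih => exact ih.maxf ((hS.alX (j + 1)).powr q)

lemma meas_rmax (hS : DiscSys P J K x0 F κ X β θ Δ) (q j k : ℕ) (hk : j ≤ k) :
    Measurable[F k] (fun ω => rmax (fun i => X i ω ^ q) j) := by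
  induction j with
  | zero => exact (hS.Xm 0 k hk).pow_const q
  | succ j ih => exact (ih (by omega)).max ((hS.Xm (j + 1) k hk).pow_const q)

lemma rmax_moment (hS : DiscSys P J K x0 F κ X β θ Δ) (n : ℕ) (hn : Even n) :
    ∫ ω, (rmax (fun i => X i ω ^ (n + 2)) J) ^ 2 ∂P ≤ xB K x0 n := by
  have hq : Even (n + 2) := hn.add even_two
  have hJ := hS.dJ
  have hJ' : (0 : ℝ) < J := by exact_mod_cast hS.J_pos
  have hc := fun c : ℝ => AL.const (P := P) c
  set δ := 1 / (J : ℝ) with hδ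
  let S : ℕ → Ω → ℝ := fun j ω => rmax (fun i => X i ω ^ (n + 2)) j
  have hS0 : ∀ j ω, 0 ≤ S j ω := fun j ω =>
    (hq.pow_nonneg (X 0 ω)).trans (le_rmax (fun i => X i ω ^ (n + 2)) (Nat.zero_le j))
  have aS : ∀ j, AL P (S j) := fun j => hS.al_rmax (n + 2) j
  let B : ℕ → Ω → ℝ := fun j ω => |X j ω| + |β j ω| + |θ j ω|
  have aB : ∀ j, AL P (B j) := hS.alB
  let T : ℕ → Ω → ℝ := fun j ω => S j ω * X j ω ^ (n + 1) * θ j ω * Δ j ω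
  have aT : ∀ j, AL P (T j) := fun j => (((aS j).mul ((hS.alX j).powr _)).mul (hS.alθ j)).mul
    (AL_of_law (hS.Δm j) (hS.law j))
  have hT : ∀ j, ∫ ω, T j ω ∂P = 0 := fun j =>
    indep_zero (hS.F_le j) (hS.Δm j) (hS.ind j) (hS.law j)
      (((hS.meas_rmax (n + 2) j j le_rfl).mul ((hS.Xm j j le_rfl).pow_const (n + 1))).mul (hS.θm j))
  have key : ∀ ω, (S J ω) ^ 2 ≤ 4 * X J ω ^ (2 * n + 2 + 2) +
      ∑ i ∈ Finset.range J, (δ * (1 / 2 * S J ω ^ 2 + 8 * (n + 2) ^ 2 * B i ω ^ (2 * n + 4))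
        + (-4 * (n + 2)) * T i ω) := by
    intro ω
    refine (doob_path (fun i => X i ω ^ (n + 2)) J).trans ?_
    rw [sub_eq_add_neg, ← mul_neg, ← Finset.sum_neg_distrib, Finset.mul_sum]
    refine add_le_add (le_of_eq (by ring)) (Finset.sum_le_sum fun i hi => ?_)
    have hi' : i ≤ J := (Finset.mem_range.1 hi).le
    have ht := even_tangent (X i ω) (δ * β i ω + θ i ω * Δ i ω) (n + 2) hq
    rw [show X i ω + (δ * β i ω + θ i ω * Δ i ω) = X (i + 1) ω by rw [hS.Xs]; ring,
      show n + 2 - 1 = n + 1 by omega] at ht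
    push_cast at ht
    have hSi := hS0 i ω
    have hm : S i ω ≤ S J ω := rmax_mono (fun i => X i ω ^ (n + 2)) hi'
    have hXB : |X i ω| ≤ B i ω := by
      simp only [B]; linarith [abs_nonneg (β i ω), abs_nonneg (θ i ω)]
    have hβB : |β i ω| ≤ B i ω := by
      simp only [B]; linarith [abs_nonneg (X i ω), abs_nonneg (θ i ω)]
    have hB0 : 0 ≤ B i ω := (abs_nonneg _).trans hXB
    have h2 : -(X i ω ^ (n + 1) * β i ω) ≤ B i ω ^ (n + 2) := by
      refine (neg_le_abs _).trans ?_
      rw [abs_mul, abs_pow, pow_succ (B i ω) (n + 1)]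
      gcongr
    have h3 := mul_le_mul_of_nonneg_left ht hSi
    have h4 := mul_le_mul_of_nonneg_left h2
      (by have := hJ.1; positivity : 0 ≤ 4 * ((n : ℝ) + 2) * δ * S i ω)
    have h5 : 4 * ((n : ℝ) + 2) * (S i ω * B i ω ^ (n + 2)) ≤
        1 / 2 * S J ω ^ 2 + 8 * (n + 2) ^ 2 * B i ω ^ (2 * n + 4) := by
      have e : B i ω ^ (2 * n + 4) = (B i ω ^ (n + 2)) ^ 2 := by ring
      have e2 : S i ω ^ 2 ≤ S J ω ^ 2 := by gcongr
      rw [e]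
      nlinarith [sq_nonneg (S i ω - 4 * ((n : ℝ) + 2) * B i ω ^ (n + 2))]
    have h6 := mul_le_mul_of_nonneg_left h5 hJ.1
    change 4 * -(S i ω * (X (i + 1) ω ^ (n + 2) - X i ω ^ (n + 2))) ≤ _
    simp only [T]
    nlinarith
  have aSJ := (aS J).powr 2
  have aI : ∀ i, AL P (fun ω => δ * (1 / 2 * S J ω ^ 2 + 8 * (n + 2) ^ 2 * B i ω ^ (2 * n + 4))) :=
    fun i => (hc δ).mul (((hc _).mul aSJ).add ((hc _).mul ((aB i).powr _)))
  have aX' := (hc 4).mul ((hS.alX J).powr (2 * n + 2 + 2))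
  have hB : ∀ i ≤ J, ∫ ω, B i ω ^ (2 * n + 4) ∂P ≤
      cB K (2 * n + 4) * (1 + mB K x0 (2 * n + 2) + mB K x0 (2 * n + 2)) := by
    intro i hi
    refine (hS.B_moment i (2 * n + 4) (by simp [parity_simps])).trans ?_
    have e : Even (2 * n + 2) := by simp [parity_simps]
    have := hS.moment (2 * n + 2) e i hi
    have := hS.moment (2 * n + 2) e (κ i) ((hS.κ_le i).trans hi)
    have := hS.cB_nonneg (2 * n + 4)
    gcongr
  have hX' := hS.moment (2 * n + 2) (by simp [parity_simps]) J le_rfl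
  have iS : ∀ i, Integrable (fun ω => δ * (1 / 2 * S J ω ^ 2 +
      8 * (n + 2) ^ 2 * B i ω ^ (2 * n + 4)) + (-4 * (n + 2)) * T i ω) P :=
    fun i => (aI i).intg.add ((hc (-4 * (n + 2))).mul (aT i)).intg
  have iSum := integrable_finsetSum (Finset.range J) fun i _ => iS i
  have hint := integral_mono aSJ.intg (aX'.intg.add iSum) key
  set b2 := cB K (2 * n + 4) * (1 + mB K x0 (2 * n + 2) + mB K x0 (2 * n + 2)) with hb2
  set E := ∫ ω, S J ω ^ 2 ∂P with hE
  have e1 : ∀ i ∈ Finset.range J, ∫ ω, (δ * (1 / 2 * S J ω ^ 2 +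
      8 * (n + 2) ^ 2 * B i ω ^ (2 * n + 4)) + (-4 * (n + 2)) * T i ω) ∂P
      ≤ δ * (1 / 2 * E + 8 * (n + 2) ^ 2 * b2) := by
    intro i hi
    rw [integral_add (aI i).intg ((hc (-4 * (n + 2))).mul (aT i)).intg, integral_const_mul,
      integral_const_mul, hT, integral_add ((hc _).mul aSJ).intg ((hc _).mul ((aB i).powr _)).intg,
      integral_const_mul, integral_const_mul]
    have := hB i (Finset.mem_range.1 hi).le
    have h1 := hJ.1
    rw [mul_zero, add_zero]
    gcongr
  have e2 : ∫ ω, (4 * X J ω ^ (2 * n + 2 + 2) +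
      ∑ i ∈ Finset.range J, (δ * (1 / 2 * S J ω ^ 2 + 8 * (n + 2) ^ 2 * B i ω ^ (2 * n + 4))
        + (-4 * (n + 2)) * T i ω)) ∂P ≤ 4 * mB K x0 (2 * n + 2) +
        (1 / 2 * E + 8 * (n + 2) ^ 2 * b2) := by
    rw [integral_add aX'.intg iSum, integral_const_mul, integral_finsetSum _ fun i _ => iS i]
    refine add_le_add (by linarith) ((Finset.sum_le_sum e1).trans (le_of_eq ?_))
    rw [Finset.sum_const, Finset.card_range, nsmul_eq_mul, hδ]
    field_simp
  have := hint.trans e2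
  unfold xB
  rw [← hb2]
  change E ≤ _
  have h3 : E ≤ 4 * mB K x0 (2 * n + 2) + (1 / 2 * E + 8 * (n + 2) ^ 2 * b2) := this
  linarith

end DiscSys


section approx
variable {Ω : Type*}

noncomputable def tg (N L j : ℕ) : ℝ := (j : ℝ) / ((N * L : ℕ) : ℝ)

def inI (W : ℝ → Ω → ℝ) (N L : ℕ) (A : ℝ) (j : ℕ) (ω : Ω) : Prop :=
  ∃ m : ℕ, ∀ r : ℚ, |W (((j / L : ℕ) : ℝ) * (1 / N) +
    max 0 (min 1 (r : ℝ)) * (tg N L j - ((j / L : ℕ) : ℝ) * (1 / N))) ω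
      - W (((j / L : ℕ) : ℝ) * (1 / N)) ω| ≤ A - 1 / ((m : ℝ) + 1)

open Classical in
noncomputable def Iv (W : ℝ → Ω → ℝ) (N L : ℕ) (A : ℝ) (j : ℕ) (ω : Ω) : ℝ :=
  if inI W N L A j ω then 1 else 0

noncomputable def Dl (W : ℝ → Ω → ℝ) (N L : ℕ) (j : ℕ) (ω : Ω) : ℝ :=
  W (tg N L (j + 1)) ω - W (tg N L j) ω

noncomputable def Dd (W : ℝ → Ω → ℝ) (N L : ℕ) (A : ℝ) (k l : ℕ) (ω : Ω) : ℝ :=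
  ∑ i ∈ Finset.range l, Iv W N L A (k * L + i) ω * Dl W N L (k * L + i) ω

noncomputable def Zd (W : ℝ → Ω → ℝ) (N L : ℕ) (A : ℝ) (b σ : ℝ → ℝ) (x₀ : ℝ) : ℕ → Ω → ℝ
  | 0 => fun _ => x₀
  | k + 1 => fun ω => Zd W N L A b σ x₀ k ω + 1 / N * b (Zd W N L A b σ x₀ k ω) +
      σ (Zd W N L A b σ x₀ k ω) * Dd W N L A k L ω

noncomputable def Xd (W : ℝ → Ω → ℝ) (N L : ℕ) (A : ℝ) (b σ : ℝ → ℝ) (x₀ : ℝ) (j : ℕ) (ω : Ω) : ℝ :=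
  Zd W N L A b σ x₀ (j / L) ω + tg N L (j % L) * b (Zd W N L A b σ x₀ (j / L) ω) +
      σ (Zd W N L A b σ x₀ (j / L) ω) * Dd W N L A (j / L) (j % L) ω

lemma Xd_eq (W : ℝ → Ω → ℝ) {N L : ℕ} (hN : 0 < N) (hL : 0 < L) (A : ℝ) (b σ : ℝ → ℝ) (x₀ : ℝ)
    (k l : ℕ) (hl : l ≤ L) (ω : Ω) : Xd W N L A b σ x₀ (k * L + l) ω =
      Zd W N L A b σ x₀ k ω + tg N L l * b (Zd W N L A b σ x₀ k ω) +
      σ (Zd W N L A b σ x₀ k ω) * Dd W N L A k l ω := by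
  unfold Xd
  rcases hl.lt_or_eq with h | h
  · have h1 : (k * L + l) / L = k := by
      rw [mul_comm, Nat.mul_add_div hL, Nat.div_eq_of_lt h, add_zero]
    have h2 : (k * L + l) % L = l := by
      rw [mul_comm, Nat.mul_add_mod, Nat.mod_eq_of_lt h]
    rw [h1, h2]
  · subst h
    have h1 : (k * l + l) / l = k + 1 := by
      rw [← Nat.succ_mul]; exact Nat.mul_div_cancel _ hL
    have h2 : (k * l + l) % l = 0 := by
      rw [← Nat.succ_mul]; exact Nat.mul_mod_left _ _
    rw [h1, h2]
    have h3 : tg N l l = 1 / N := by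
      have : (l : ℝ) ≠ 0 := by positivity
      have : (N : ℝ) ≠ 0 := by positivity
      unfold tg; push_cast; field_simp
    rw [h3]
    simp [tg, Dd, Zd]

lemma Xd_step (W : ℝ → Ω → ℝ) {N L : ℕ} (hN : 0 < N) (hL : 0 < L) (A : ℝ) (b σ : ℝ → ℝ) (x₀ : ℝ)
    (j : ℕ) (ω : Ω) : Xd W N L A b σ x₀ (j + 1) ω = Xd W N L A b σ x₀ j ω +
      1 / ((N * L : ℕ) : ℝ) * b (Xd W N L A b σ x₀ (j / L * L) ω) +
      (σ (Xd W N L A b σ x₀ (j / L * L) ω) * Iv W N L A j ω) * Dl W N L j ω := by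
  have hj : j / L * L + j % L = j := Nat.div_add_mod' j L
  have hlt : j % L < L := Nat.mod_lt j hL
  set k := j / L
  set l := j % L
  have e0 := Xd_eq W hN hL A b σ x₀ k 0 (Nat.zero_le _) ω
  have e1 := Xd_eq W hN hL A b σ x₀ k l hlt.le ω
  have e2 := Xd_eq W hN hL A b σ x₀ k (l + 1) hlt ω
  simp only [add_zero, tg, Nat.cast_zero, zero_div, zero_mul, Dd, Finset.range_zero,
    Finset.sum_empty, mul_zero] at e0
  rw [← add_assoc, hj] at e2
  rw [hj] at e1
  rw [e0, e1, e2]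
  simp only [Dd, Finset.sum_range_succ, hj, tg]
  push_cast
  ring

end approx

section meas
variable {Ω : Type*} [mΩ : MeasurableSpace Ω]

@[reducible]
def Ft (W : ℝ → Ω → ℝ) (t : ℝ) : MeasurableSpace Ω :=
  ⨆ r ∈ Set.Icc (0 : ℝ) t, MeasurableSpace.comap (W r) inferInstance

lemma Ft_meas (W : ℝ → Ω → ℝ) {t r : ℝ} (h0 : 0 ≤ r) (h1 : r ≤ t) : Measurable[Ft W t] (W r) := by
  have h : MeasurableSpace.comap (W r) inferInstance ≤ Ft W t :=
    le_iSup₂_of_le r ⟨h0, h1⟩ le_rfl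
  exact (comap_measurable (W r)).mono h le_rfl

lemma Ft_mono (W : ℝ → Ω → ℝ) {t r : ℝ} (h1 : r ≤ t) : Ft W r ≤ Ft W t :=
  iSup₂_le fun s hs => le_iSup₂_of_le s ⟨hs.1, hs.2.trans h1⟩ le_rfl

lemma Ft_le (W : ℝ → Ω → ℝ) (hW : ∀ t, Measurable (W t)) (t : ℝ) : Ft W t ≤ mΩ :=
  iSup₂_le fun s hs => (hW s).comap_le

lemma tg_nonneg (N L j : ℕ) : 0 ≤ tg N L j := by unfold tg; positivity

lemma tg_mono (N L : ℕ) {i j : ℕ} (h : i ≤ j) : tg N L i ≤ tg N L j := by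
  unfold tg; gcongr

lemma tg_kL {N L : ℕ} (hN : 0 < N) (hL : 0 < L) (k : ℕ) : tg N L (k * L) = k * (1 / N) := by
  have : (L : ℝ) ≠ 0 := by positivity
  have : (N : ℝ) ≠ 0 := by positivity
  unfold tg; push_cast; field_simp

lemma tg_div {N L : ℕ} (hN : 0 < N) (hL : 0 < L) (j : ℕ) :
    ((j / L : ℕ) : ℝ) * (1 / N) ≤ tg N L j := by
  rw [← tg_kL hN hL]; exact tg_mono N L (Nat.div_mul_le_self j L)

lemma Iv_meas (W : ℝ → Ω → ℝ) {N L : ℕ} (hN : 0 < N) (hL : 0 < L) (A : ℝ) (j : ℕ) :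
    Measurable[Ft W (tg N L j)] (Iv W N L A j) := by
  have hk := tg_div hN hL j
  have hk0 : 0 ≤ ((j / L : ℕ) : ℝ) * (1 / N) := by positivity
  have hs : MeasurableSet[Ft W (tg N L j)] {ω | inI W N L A j ω} := by
    unfold inI
    simp only [Set.ofPred_exists, Set.ofPred_forall]
    refine MeasurableSet.iUnion fun m => MeasurableSet.iInter fun r => ?_
    set x : ℝ := max 0 (min 1 (r : ℝ))
    have hx0 : 0 ≤ x := le_max_left _ _
    have hx1 : x ≤ 1 := max_le zero_le_one (min_le_left _ _)
    have m1 := Ft_meas W (t := tg N L j) (r := ((j / L : ℕ) : ℝ) * (1 / N) +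
      x * (tg N L j - ((j / L : ℕ) : ℝ) * (1 / N))) (by
        have := mul_nonneg hx0 (sub_nonneg.2 hk); linarith)
        (by nlinarith)
    have m2 := Ft_meas W (t := tg N L j) hk0 hk
    have m3 : Measurable[Ft W (tg N L j)] fun ω => |W (((j / L : ℕ) : ℝ) * (1 / N) +
      x * (tg N L j - ((j / L : ℕ) : ℝ) * (1 / N))) ω - W (((j / L : ℕ) : ℝ) * (1 / N)) ω| :=
      continuous_abs.measurable.comp (m1.sub m2)
    exact m3 measurableSet_Iic
  unfold Iv
  exact Measurable.ite hs measurable_const measurable_const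

lemma Dl_meas (W : ℝ → Ω → ℝ) {N L : ℕ} (j t : ℕ) (h : j + 1 ≤ t) :
    Measurable[Ft W (tg N L t)] (Dl W N L j) :=
  (Ft_meas W (tg_nonneg _ _ _) (tg_mono N L h)).sub
    (Ft_meas W (tg_nonneg _ _ _) (tg_mono N L (by omega)))

lemma Dd_meas (W : ℝ → Ω → ℝ) {N L : ℕ} (hN : 0 < N) (hL : 0 < L) (A : ℝ) (k l t : ℕ)
    (h : k * L + l ≤ t) : Measurable[Ft W (tg N L t)] (Dd W N L A k l) := by
  unfold Dd
  refine Finset.measurable_sum _ fun i hi => ?_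
  have := Finset.mem_range.1 hi
  exact ((Iv_meas W hN hL A (k * L + i)).mono (Ft_mono W (tg_mono N L (by omega))) le_rfl).mul
    (Dl_meas W _ _ (by omega))

lemma Zd_meas (W : ℝ → Ω → ℝ) {N L : ℕ} (hN : 0 < N) (hL : 0 < L) (A : ℝ) {b σ : ℝ → ℝ}
    (hb : Measurable b) (hσ : Measurable σ) (x₀ : ℝ) (k t : ℕ)
    (h : k * L ≤ t) : Measurable[Ft W (tg N L t)] (Zd W N L A b σ x₀ k) := by
  induction k with
  | zero => exact measurable_const
  | succ k ih =>
    have h' : k * L + L ≤ t := by rw [← Nat.succ_mul]; exact h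
    have hz := ih (by omega)
    exact (hz.add ((hb.comp hz).const_mul _)).add
      ((hσ.comp hz).mul (Dd_meas W hN hL A k L t h'))

lemma Xd_meas (W : ℝ → Ω → ℝ) {N L : ℕ} (hN : 0 < N) (hL : 0 < L) (A : ℝ) {b σ : ℝ → ℝ}
    (hb : Measurable b) (hσ : Measurable σ) (x₀ : ℝ) (j t : ℕ)
    (h : j ≤ t) : Measurable[Ft W (tg N L t)] (Xd W N L A b σ x₀ j) := by
  have hz := Zd_meas W hN hL A hb hσ x₀ (j / L) t ((Nat.div_mul_le_self j L).trans h)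
  exact (hz.add ((hb.comp hz).const_mul _)).add
      ((hσ.comp hz).mul (Dd_meas W hN hL A _ _ t (by rw [Nat.div_add_mod']; exact h)))

lemma lip_growth {C : ℝ≥0} {b : ℝ → ℝ} (hb : LipschitzWith C b) {B : ℝ≥0} (h0 : |b 0| ≤ B)
    (x : ℝ) : |b x| ≤ (B + C) * (1 + |x|) := by
  have := hb.dist_le_mul x 0
  rw [Real.dist_eq, Real.dist_eq, sub_zero] at this
  have h2 : |b x| ≤ |b x - b 0| + |b 0| := by simpa using abs_add_le (b x - b 0) (b 0)
  have hB : (0 : ℝ) ≤ B := B.2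
  have hC : (0 : ℝ) ≤ C := C.2
  nlinarith [mul_nonneg hB (abs_nonneg x)]

lemma discSys_Xd {P : Measure Ω} {W : ℝ → Ω → ℝ} (hW : IsBrownianMotion P W)
    {N L : ℕ} (hN : 0 < N) (hL : 0 < L) (A : ℝ) {b σ : ℝ → ℝ} {C₀ C₁ B₀ B₁ : ℝ≥0}
    (hb : LipschitzWith C₀ b) (hσ : LipschitzWith C₁ σ) (hb0 : |b 0| ≤ B₀) (hσ0 : |σ 0| ≤ B₁)
    (x₀ : ℝ) :
    DiscSys P (N * L) ((B₀ + C₀ : ℝ) + (B₁ + C₁)) x₀ (fun j => Ft W (tg N L j))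
      (fun j => j / L * L)
      (Xd W N L A b σ x₀) (fun j ω => b (Xd W N L A b σ x₀ (j / L * L) ω))
      (fun j ω => σ (Xd W N L A b σ x₀ (j / L * L) ω) * Iv W N L A j ω) (Dl W N L) where
  J_pos := Nat.mul_pos hN hL
  K_nonneg := by positivity
  F_le j := Ft_le W hW.meas _
  κ_le j := Nat.div_mul_le_self j L
  Xm i j hij := Xd_meas W hN hL A hb.continuous.measurable hσ.continuous.measurable x₀ i j hij
  βm j := hb.continuous.measurable.comp (Xd_meas W hN hL A hb.continuous.measurable
    hσ.continuous.measurable x₀ _ j (Nat.div_mul_le_self j L))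
  θm j := (hσ.continuous.measurable.comp (Xd_meas W hN hL A hb.continuous.measurable
    hσ.continuous.measurable x₀ _ j (Nat.div_mul_le_self j L))).mul (Iv_meas W hN hL A j)
  Δm j := (hW.meas _).sub (hW.meas _)
  law j := by
    have := hW.incr (tg N L j) (tg N L (j + 1)) (tg_nonneg _ _ _) (tg_mono N L (by omega))
    rw [show tg N L (j + 1) - tg N L j = 1 / ((N * L : ℕ) : ℝ) by
      unfold tg; push_cast; ring] at this
    exact this
  ind j := hW.indep (tg N L j) (tg N L (j + 1)) (tg_nonneg _ _ _) (tg_mono N L (by omega))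
  βb j ω := by
    have := lip_growth hb hb0 (Xd W N L A b σ x₀ (j / L * L) ω)
    have h2 : (0 : ℝ) ≤ (B₁ + C₁) * (1 + |Xd W N L A b σ x₀ (j / L * L) ω|) := by positivity
    rw [add_mul]; linarith
  θb j ω := by
    have := lip_growth hσ hσ0 (Xd W N L A b σ x₀ (j / L * L) ω)
    have h2 : (0 : ℝ) ≤ (B₀ + C₀) * (1 + |Xd W N L A b σ x₀ (j / L * L) ω|) := by positivity
    have h3 : |Iv W N L A j ω| ≤ 1 := by unfold Iv; split_ifs <;> simp
    rw [add_mul, abs_mul]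
    have := mul_le_mul_of_nonneg_left h3 (abs_nonneg (σ (Xd W N L A b σ x₀ (j / L * L) ω)))
    linarith
  X0 ω := by
    have := Xd_eq W hN hL A b σ x₀ 0 0 (Nat.zero_le _) ω
    simpa [tg, Dd, Zd] using this
  Xs j ω := Xd_step W hN hL A b σ x₀ j ω

end meas


section path
variable {Ω : Type*}

lemma truncStop_spec {W : ℝ → Ω → ℝ} {h A : ℝ} {k : ℕ} {ω : Ω}
    (hc : Continuous fun t => W t ω) (hex : ∃ s, k * h ≤ s ∧ A ≤ |W s ω - W (k * h) ω|) :
    k * h ≤ truncStop W h A k ω ∧ A ≤ |W (truncStop W h A k ω) ω - W (k * h) ω| ∧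
      ∀ s, k * h ≤ s → s < truncStop W h A k ω → |W s ω - W (k * h) ω| < A := by
  have hcl : IsClosed {s : ℝ | k * h ≤ s ∧ A ≤ |W s ω - W (k * h) ω|} := by
    have h2 : Continuous fun s => |W s ω - W (k * h) ω| := by fun_prop
    exact (isClosed_le (f := fun _ : ℝ => k * h) (g := fun s : ℝ => s) continuous_const
      continuous_id).inter (isClosed_le continuous_const h2)
  have hbd : BddBelow {s : ℝ | k * h ≤ s ∧ A ≤ |W s ω - W (k * h) ω|} := ⟨k * h, fun s hs => hs.1⟩
  have hmem := hcl.csInf_mem hex hbd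
  refine ⟨hmem.1, hmem.2, fun s hs hlt => ?_⟩
  by_contra hcon
  exact absurd (csInf_le hbd ⟨hs, not_lt.1 hcon⟩) (not_le.2 hlt)

lemma inI_iff {W : ℝ → Ω → ℝ} {N L : ℕ} (hN : 0 < N) (hL : 0 < L) {A : ℝ} {j : ℕ} {ω : Ω}
    (hc : Continuous fun t => W t ω)
    (hex : ∃ s, ((j / L : ℕ) : ℝ) * (1 / N) ≤ s ∧ A ≤ |W s ω - W (((j / L : ℕ) : ℝ) * (1 / N)) ω|) :
    inI W N L A j ω ↔ tg N L j < truncStop W (1 / N) A (j / L) ω := by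
  obtain ⟨h1, h2, h3⟩ := truncStop_spec hc hex
  have hk := tg_div hN hL j
  unfold inI
  set a := ((j / L : ℕ) : ℝ) * (1 / N)
  set t := tg N L j
  set τ := truncStop W (1 / N) A (j / L) ω
  have hcont : Continuous fun x : ℝ => |W (a + max 0 (min 1 x) * (t - a)) ω - W a ω| := by
    have : Continuous fun x : ℝ => a + max 0 (min 1 x) * (t - a) := by fun_prop
    exact ((hc.comp this).sub continuous_const).abs
  constructor
  · rintro ⟨m, hm⟩
    by_contra hcon
    have hτ : τ ≤ t := not_lt.1 hcon
    have hall : ∀ x : ℝ, |W (a + max 0 (min 1 x) * (t - a)) ω - W a ω| ≤ A - 1 / ((m : ℝ) + 1) :=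
      fun x => (Rat.denseRange_cast (𝕜 := ℝ)).induction_on
        (p := fun x => |W (a + max 0 (min 1 x) * (t - a)) ω - W a ω| ≤ A - 1 / ((m : ℝ) + 1)) x
        (isClosed_le hcont continuous_const) hm
    have hp : 0 < 1 / ((m : ℝ) + 1) := by positivity
    rcases hk.lt_or_eq with h | h
    · have h4 := hall ((τ - a) / (t - a))
      have ht : 0 < t - a := by linarith
      have e1 : (τ - a) / (t - a) ≤ 1 := by rw [div_le_one ht]; linarith
      have e0 : 0 ≤ (τ - a) / (t - a) := div_nonneg (by linarith) ht.le
      rw [min_eq_right e1, max_eq_right e0, div_mul_cancel₀ _ ht.ne', add_sub_cancel] at h4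
      linarith
    · have h4 := hall 0
      have : τ = a := by linarith
      rw [this] at h2
      simp only [← h, sub_self, mul_zero, add_zero] at h4
      rw [sub_self] at h2
      rw [abs_zero] at h2 h4
      linarith
  · intro hlt
    obtain ⟨x, hx, hmax⟩ := (isCompact_Icc (a := (0 : ℝ)) (b := 1)).exists_isMaxOn
      ⟨0, by simp⟩ hcont.continuousOn
    have hcl : ∀ y : ℝ, 0 ≤ max 0 (min 1 y) ∧ max 0 (min 1 y) ≤ 1 := fun y =>
      ⟨le_max_left _ _, max_le zero_le_one (min_le_left _ _)⟩
    have hA : |W (a + max 0 (min 1 x) * (t - a)) ω - W a ω| < A := by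
      refine h3 _ ?_ ?_
      · have := mul_nonneg (hcl x).1 (sub_nonneg.2 hk); linarith
      · nlinarith [(hcl x).2]
    obtain ⟨m, hm⟩ := exists_nat_one_div_lt (sub_pos.2 hA)
    refine ⟨m, fun r => ?_⟩
    have h5 : |W (a + max 0 (min 1 (max 0 (min 1 (r : ℝ)))) * (t - a)) ω - W a ω| ≤ _ :=
      hmax (hcl r)
    rw [min_eq_right (hcl r).2, max_eq_right (hcl r).1] at h5
    simp only at h5
    linarith

lemma Dd_path {W : ℝ → Ω → ℝ} {N L : ℕ} (hN : 0 < N) (hL : 0 < L) {A : ℝ} {k : ℕ} {ω : Ω}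
    (hc : Continuous fun t => W t ω)
    (hex : ∃ s, (k : ℝ) * (1 / N) ≤ s ∧ A ≤ |W s ω - W ((k : ℝ) * (1 / N)) ω|) (l : ℕ) (hl : l ≤ L) :
    ∃ s, Dd W N L A k l ω = W s ω - W ((k : ℝ) * (1 / N)) ω ∧
      |s - min (tg N L (k * L + l)) (truncStop W (1 / N) A k ω)| ≤ 1 / ((N * L : ℕ) : ℝ) ∧
      (tg N L (k * L + l) ≤ truncStop W (1 / N) A k ω → s = tg N L (k * L + l)) := by
  obtain ⟨h1, h2, h3⟩ := truncStop_spec hc hex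
  have hd0 : 0 ≤ 1 / ((N * L : ℕ) : ℝ) := by positivity
  induction l with
  | zero =>
    refine ⟨(k : ℝ) * (1 / N), by simp [Dd], ?_, fun _ => by rw [add_zero, tg_kL hN hL]⟩
    rw [add_zero, tg_kL hN hL, min_eq_left h1, sub_self, abs_zero]; exact hd0
  | succ l ih =>
    obtain ⟨s, e1, e2, e3⟩ := ih (by omega)
    have hdiv : (k * L + l) / L = k := by
      rw [mul_comm, Nat.mul_add_div hL, Nat.div_eq_of_lt (by omega), add_zero]
    have hI := inI_iff hN hL (j := k * L + l) (A := A) hc (by rw [hdiv]; exact hex)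
    rw [hdiv] at hI
    have hstep : tg N L (k * L + l + 1) = tg N L (k * L + l) + 1 / ((N * L : ℕ) : ℝ) := by
      unfold tg; push_cast; ring
    have hDs : Dd W N L A k (l + 1) ω = Dd W N L A k l ω +
      Iv W N L A (k * L + l) ω * Dl W N L (k * L + l) ω := by
      simp only [Dd, Finset.sum_range_succ]
    rw [← add_assoc]
    set τ := truncStop W (1 / N) A k ω
    rcases lt_or_ge (tg N L (k * L + l)) τ with h | h
    · refine ⟨tg N L (k * L + l + 1), ?_, ?_, fun _ => rfl⟩
      · rw [hDs, e1, e3 h.le, Iv, if_pos (hI.2 h), Dl]; ring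
      · rcases le_total (tg N L (k * L + l + 1)) τ with h' | h'
        · rw [min_eq_left h', sub_self, abs_zero]; exact hd0
        · rw [min_eq_right h', abs_of_nonneg (by linarith)]; linarith
    · refine ⟨s, ?_, ?_, fun h' => ?_⟩
      · rw [hDs, e1, Iv, if_neg (fun hh => absurd (hI.1 hh) (not_lt.2 h))]; ring
      · rw [min_eq_right (by linarith)]; rwa [min_eq_right h] at e2
      · have : 0 < 1 / ((N * L : ℕ) : ℝ) := by positivity
        linarith

open Filter Topology

lemma delta_tendsto {N : ℕ} (hN : 0 < N) :
    Tendsto (fun n : ℕ => 1 / ((N * (n + 1) : ℕ) : ℝ)) atTop (𝓝 0) := by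
  refine squeeze_zero (fun n => by positivity) (fun n => ?_) tendsto_one_div_add_atTop_nhds_zero_nat
  have h1 : (1 : ℝ) ≤ N := by exact_mod_cast hN
  have h2 : (0 : ℝ) ≤ n := Nat.cast_nonneg n
  push_cast
  gcongr
  nlinarith

lemma Dd_tendsto {W : ℝ → Ω → ℝ} {N : ℕ} (hN : 0 < N) {A : ℝ} {k : ℕ} {ω : Ω}
    (hc : Continuous fun t => W t ω)
    (hex : ∃ s, (k : ℝ) * (1 / N) ≤ s ∧ A ≤ |W s ω - W ((k : ℝ) * (1 / N)) ω|)
    (l : ℕ → ℕ) (hl : ∀ n, l n ≤ n + 1) (t : ℝ)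
    (ht : Tendsto (fun n => tg N (n + 1) (k * (n + 1) + l n)) atTop (𝓝 t)) :
    Tendsto (fun n => Dd W N (n + 1) A k (l n) ω) atTop
      (𝓝 (W (min t (truncStop W (1 / N) A k ω)) ω - W ((k : ℝ) * (1 / N)) ω)) := by
  choose s hs1 hs2 hs3 using fun n : ℕ =>
    Dd_path hN (Nat.succ_pos n) hc hex (l n) (hl n)
  simp only [Nat.succ_eq_add_one] at hs1 hs2
  have h1 : Tendsto (fun n => s n - min (tg N (n + 1) (k * (n + 1) + l n))
      (truncStop W (1 / N) A k ω)) atTop (𝓝 0) :=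
    squeeze_zero_norm (fun n => by simpa using hs2 n) (by simpa using delta_tendsto hN)
  have h2 := h1.add (ht.min (tendsto_const_nhds (x := truncStop W (1 / N) A k ω)))
  simp only [sub_add_cancel, zero_add] at h2
  simp only [hs1]
  exact ((hc.tendsto _).comp h2).sub_const _

noncomputable def Ah (N : ℕ) : ℝ := 4 * Real.sqrt ((1 / N : ℝ) * Real.log (1 / (1 / N : ℝ)))

lemma truncWiener_diff {W : ℝ → Ω → ℝ} {N : ℕ} (hN : 0 < N) {k : ℕ} (hk : k < N) {ω : Ω}
    (hc : Continuous fun t => W t ω)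
    (hex : ∃ s, (k : ℝ) * (1 / N) ≤ s ∧ Ah N ≤ |W s ω - W ((k : ℝ) * (1 / N)) ω|) (t : ℝ)
    (h0 : k * (1 / N : ℝ) ≤ t) (h1 : t ≤ (k + 1) * (1 / N : ℝ)) :
    truncWiener W N t ω - truncWiener W N (k * (1 / N : ℝ)) ω =
      W (min t (truncStop W (1 / N) (Ah N) k ω)) ω - W ((k : ℝ) * (1 / N)) ω := by
  obtain ⟨hτ, -, -⟩ := truncStop_spec hc hex
  have hh : (0 : ℝ) < 1 / N := by positivity
  unfold truncWiener
  simp only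
  rw [← Finset.sum_sub_distrib, Finset.sum_eq_single k]
  · change W (min (min (max t (k * (1 / N : ℝ))) ((k + 1) * (1 / N : ℝ)))
      (truncStop W (1 / N) (Ah N) k ω)) ω - W ((k : ℝ) * (1 / N)) ω -
      (W (min (min (max (k * (1 / N : ℝ)) (k * (1 / N : ℝ))) ((k + 1) * (1 / N : ℝ)))
      (truncStop W (1 / N) (Ah N) k ω)) ω - W ((k : ℝ) * (1 / N)) ω) = _
    rw [max_eq_left h0, min_eq_left h1, max_self,
      min_eq_left (a := (k : ℝ) * (1 / N)) (by linarith), min_eq_left hτ]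
    ring
  · intro i _ hik
    have : max t (i * (1 / N : ℝ)) ⊓ ((i + 1) * (1 / N : ℝ)) =
        max (k * (1 / N : ℝ)) (i * (1 / N : ℝ)) ⊓ ((i + 1) * (1 / N : ℝ)) := by
      rcases lt_or_gt_of_ne hik with h | h
      · have h' : (i : ℝ) + 1 ≤ k := by exact_mod_cast h
        have h2 : ((i : ℝ) + 1) * (1 / N : ℝ) ≤ k * (1 / N : ℝ) := by gcongr
        rw [min_eq_right, min_eq_right]
        · exact le_max_of_le_left h2
        · exact le_max_of_le_left (h2.trans h0)
      · have h' : (k : ℝ) + 1 ≤ i := by exact_mod_cast h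
        have h2 : ((k : ℝ) + 1) * (1 / N : ℝ) ≤ i * (1 / N : ℝ) := by gcongr
        rw [max_eq_right (h1.trans h2), max_eq_right (by linarith)]
    rw [this]; ring
  · intro h; exact absurd (Finset.mem_range.2 hk) h

lemma Zd_tendsto {W : ℝ → Ω → ℝ} {N : ℕ} (hN : 0 < N) {b σ : ℝ → ℝ} (hb : Continuous b)
    (hσ : Continuous σ) (x₀ : ℝ) {ω : Ω}
    (hc : Continuous fun t => W t ω)
    (hex : ∀ k : ℕ, ∃ s, (k : ℝ) * (1 / N) ≤ s ∧ Ah N ≤ |W s ω - W ((k : ℝ) * (1 / N)) ω|)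
    (k : ℕ) (hk : k ≤ N) :
    Tendsto (fun n => Zd W N (n + 1) (Ah N) b σ x₀ k ω) atTop (𝓝 (monEMdisc W N b σ x₀ k ω)) := by
  induction k with
  | zero => exact tendsto_const_nhds
  | succ k ih =>
    have hz := ih (by omega)
    have hh : (0 : ℝ) < 1 / N := by positivity
    have hD := Dd_tendsto hN hc (hex k) (fun n => n + 1) (fun n => le_rfl)
      (((k + 1 : ℕ) : ℝ) * (1 / N)) (by
        refine tendsto_const_nhds.congr fun n => ?_
        rw [← Nat.succ_mul]; exact (tg_kL hN (Nat.succ_pos n) _).symm)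
    have e := truncWiener_diff hN (show k < N by omega) hc (hex k) (((k + 1 : ℕ) : ℝ) * (1 / N))
      (by push_cast; linarith) (by push_cast; exact le_rfl)
    rw [← e] at hD
    simp only [Zd, monEMdisc]
    push_cast at hD
    exact (hz.add (((hb.tendsto _).comp hz).const_mul _)).add (((hσ.tendsto _).comp hz).mul hD)

lemma Xd_tendsto {W : ℝ → Ω → ℝ} {N : ℕ} (hN : 0 < N) {b σ : ℝ → ℝ} (hb : Continuous b)
    (hσ : Continuous σ) (x₀ : ℝ) {ω : Ω}
    (hc : Continuous fun t => W t ω)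
    (hex : ∀ k : ℕ, ∃ s, (k : ℝ) * (1 / N) ≤ s ∧ Ah N ≤ |W s ω - W ((k : ℝ) * (1 / N)) ω|)
    (t : ℝ) (h0 : 0 ≤ t) (h1 : t ≤ 1) :
    ∃ j : ℕ → ℕ, (∀ n, j n ≤ N * (n + 1)) ∧
      Tendsto (fun n => Xd W N (n + 1) (Ah N) b σ x₀ (j n) ω) atTop (𝓝 (monEM W N b σ x₀ t ω)) := by
  have hN' : (0 : ℝ) < N := by positivity
  rcases h0.eq_or_lt with h | h
  · refine ⟨fun _ => 0, fun n => Nat.zero_le _, ?_⟩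
    subst h
    simp only [monEM, le_refl, if_true]
    refine tendsto_const_nhds.congr fun n => ?_
    have := Xd_eq W hN (Nat.succ_pos n) (Ah N) b σ x₀ 0 0 (Nat.zero_le _) ω
    simp [tg, Dd, Zd] at this
    exact this.symm
  · have htN : 0 < t * N := by positivity
    have hceil : 0 < ⌈t * N⌉₊ := Nat.ceil_pos.2 htN
    set k := ⌈t * N⌉₊ - 1 with hkdef
    have hk1 : k + 1 = ⌈t * N⌉₊ := by omega
    have hkN : k < N := by
      have : ⌈t * N⌉₊ ≤ N := Nat.ceil_le.2 (by nlinarith)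
      omega
    have hlo : (k : ℝ) < t * N := Nat.lt_ceil.1 (by omega)
    have hhi : t * N ≤ (k : ℝ) + 1 := by
      have := Nat.le_ceil (t * N); rw [← hk1] at this; exact_mod_cast this
    have hlo' : (k : ℝ) * (1 / N) ≤ t := by
      rw [mul_one_div, div_le_iff₀ hN']; exact hlo.le
    have hhi' : t ≤ ((k : ℝ) + 1) * (1 / N) := by
      rw [mul_one_div, le_div_iff₀ hN']; exact hhi
    let l : ℕ → ℕ := fun n => ⌊(t * N - k) * ((n + 1 : ℕ) : ℝ)⌋₊
    have hl : ∀ n, l n ≤ n + 1 := by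
      intro n
      refine Nat.floor_le_of_le ?_
      have : (0 : ℝ) ≤ ((n + 1 : ℕ) : ℝ) := Nat.cast_nonneg _
      nlinarith
    have hlt : Tendsto (fun n => tg N (n + 1) (l n)) atTop (𝓝 (t - k * (1 / N))) := by
      have hz : Tendsto (fun n => tg N (n + 1) (l n) - (t - k * (1 / N))) atTop (𝓝 0) := by
        refine squeeze_zero_norm (fun n => ?_) (delta_tendsto hN)
        have hJ : (0 : ℝ) < ((N * (n + 1) : ℕ) : ℝ) := by positivity
        have hx : 0 ≤ (t * N - k) * ((n + 1 : ℕ) : ℝ) := mul_nonneg (by linarith) (by positivity)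
        have f1 := Nat.floor_le hx
        have f2 := Nat.lt_floor_add_one ((t * N - k) * ((n + 1 : ℕ) : ℝ))
        have e : tg N (n + 1) (l n) - (t - k * (1 / N)) =
            ((l n : ℝ) - (t * N - k) * ((n + 1 : ℕ) : ℝ)) / ((N * (n + 1) : ℕ) : ℝ) := by
          unfold tg; push_cast; field_simp
        rw [e, Real.norm_eq_abs, abs_div, abs_of_pos hJ]
        gcongr
        rw [abs_le]
        constructor <;> simp only [l] <;> linarith
      simpa using hz.add_const (t - k * (1 / N : ℝ))
    refine ⟨fun n => k * (n + 1) + l n, fun n => ?_, ?_⟩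
    · have := hl n
      have : (k + 1) * (n + 1) ≤ N * (n + 1) := Nat.mul_le_mul_right _ hkN
      nlinarith
    have hadd : ∀ n, tg N (n + 1) (k * (n + 1) + l n) = k * (1 / N) + tg N (n + 1) (l n) := by
      intro n
      rw [← tg_kL hN (Nat.succ_pos n) k]; unfold tg; push_cast; ring
    have hD := Dd_tendsto hN hc (hex k) l hl t (by
      simp only [hadd]
      have := hlt.const_add (k * (1 / N : ℝ))
      simpa using this)
    rw [← truncWiener_diff hN hkN hc (hex k) t hlo' hhi'] at hD
    have hz := Zd_tendsto hN hb hσ x₀ hc hex k hkN.le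
    simp only [monEM, not_le.2 h, if_false]
    rw [← hkdef]
    refine Tendsto.congr (fun n => (Xd_eq W hN (Nat.succ_pos n) (Ah N) b σ x₀ k (l n) (hl n) ω).symm) ?_
    exact (hz.add (hlt.mul ((hb.tendsto _).comp hz))).add (((hσ.tendsto _).comp hz).mul hD)

end path


open Filter Topology in
lemma ae_exit {Ω : Type*} [MeasurableSpace Ω] {P : Measure Ω} {W : ℝ → Ω → ℝ}
    (hW : IsBrownianMotion P W) (a A : ℝ) (ha : 0 ≤ a) :
    ∀ᵐ ω ∂P, ∃ s, a ≤ s ∧ A ≤ |W s ω - W a ω| := by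
  rw [ae_iff]
  have hb : ∀ n : ℕ, P {ω | ¬ ∃ s, a ≤ s ∧ A ≤ |W s ω - W a ω|} ≤
      ENNReal.ofReal ((√(2 * Real.pi * ((n : ℝ) + 1)))⁻¹) * ENNReal.ofReal (2 * A) := by
    intro n
    have hn : (0 : ℝ) < (n : ℝ) + 1 := by positivity
    have hlaw := hW.incr a (a + (n + 1)) ha (by linarith)
    have hm : Measurable fun ω => W (a + (n + 1)) ω - W a ω := (hW.meas _).sub (hW.meas _)
    calc P {ω | ¬ ∃ s, a ≤ s ∧ A ≤ |W s ω - W a ω|}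
        ≤ P ((fun ω => W (a + (n + 1)) ω - W a ω) ⁻¹' (Set.Ioo (-A) A)) := by
          refine measure_mono fun ω hω => ?_
          by_contra hcon
          refine hω ⟨a + (n + 1), by linarith, ?_⟩
          by_contra h2
          exact hcon (abs_lt.1 (not_le.1 h2))
      _ = gaussianReal 0 (Real.toNNReal ((n : ℝ) + 1)) (Set.Ioo (-A) A) := by
          rw [← Measure.map_apply hm measurableSet_Ioo, hlaw, add_sub_cancel_left]
      _ = ∫⁻ x in Set.Ioo (-A) A, gaussianPDF 0 (Real.toNNReal ((n : ℝ) + 1)) x :=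
          gaussianReal_apply _ (by simpa using hn) _
      _ ≤ ∫⁻ x in Set.Ioo (-A) A, ENNReal.ofReal ((√(2 * Real.pi * ((n : ℝ) + 1)))⁻¹) := by
          refine lintegral_mono fun x => ?_
          refine ENNReal.ofReal_le_ofReal ?_
          rw [gaussianPDFReal, Real.coe_toNNReal _ hn.le]
          refine mul_le_of_le_one_right (by positivity) (Real.exp_le_one_iff.2 ?_)
          exact div_nonpos_of_nonpos_of_nonneg (neg_nonpos.2 (sq_nonneg _)) (by positivity)
      _ = _ := by
          rw [setLIntegral_const, Real.volume_Ioo]; congr 2; ring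
  have hlim : Tendsto (fun n : ℕ => ENNReal.ofReal ((√(2 * Real.pi * ((n : ℝ) + 1)))⁻¹) *
      ENNReal.ofReal (2 * A)) atTop (𝓝 0) := by
    have h1 : Tendsto (fun n : ℕ => (√(2 * Real.pi * ((n : ℝ) + 1)))⁻¹) atTop (𝓝 0) := by
      refine tendsto_inv_atTop_zero.comp (Real.tendsto_sqrt_atTop.comp ?_)
      exact (tendsto_atTop_add_const_right _ _ tendsto_natCast_atTop_atTop).const_mul_atTop
        (by positivity)
    have h2 := ENNReal.Tendsto.mul_const (b := ENNReal.ofReal (2 * A))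
      (ENNReal.tendsto_ofReal h1) (Or.inr ENNReal.ofReal_ne_top)
    simpa using h2
  exact le_antisymm (ge_of_tendsto' hlim hb) bot_le

lemma rpow_le_pow (p : ℝ) (hp : 1 < p) (x : ℝ) :
    |x| ^ p ≤ 1 + (x ^ (2 * ⌈p⌉₊ + 2)) ^ 2 := by
  have h0 := abs_nonneg x
  have hsq : (x ^ (2 * ⌈p⌉₊ + 2)) ^ 2 = |x| ^ ((2 * ⌈p⌉₊ + 2) * 2) := by
    rw [← pow_mul, Even.pow_abs]; exact even_two.mul_left _
  rcases le_total |x| 1 with h | h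
  · have := Real.rpow_le_one h0 h (by linarith : 0 ≤ p)
    nlinarith [sq_nonneg (x ^ (2 * ⌈p⌉₊ + 2))]
  · rw [hsq, ← Real.rpow_natCast]
    have hle : p ≤ (((2 * ⌈p⌉₊ + 2) * 2 : ℕ) : ℝ) := by
      have := Nat.le_ceil p
      push_cast; nlinarith
    have := Real.rpow_le_rpow_of_exponent_le h hle
    linarith


/-- **Uniform `L^p` moment bound for the monotone Euler–Maruyama scheme.**
For Lipschitz `b : ℝ → ℝ` and `σ : ℝ → [0,∞)` and every `p > 1` there is a constant
`C_p > 0`, depending only on `p`, `x₀`, the Lipschitz constants of `b, σ` and bounds on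
their values at `0`, such that for every `N ∈ ℕ` (with `h = 1/N`),
`E[sup_{0 ≤ t ≤ 1} |X^h_t|^p] ≤ C_p`. -/
theorem monotone_em_moment_bound
    (p : ℝ) (hp : 1 < p) (C₀ C₁ B₀ B₁ : ℝ≥0) (x₀ : ℝ) :
    ∃ C : ℝ, 0 < C ∧
      ∀ (Ω : Type) [MeasurableSpace Ω] (P : Measure Ω) (W : ℝ → Ω → ℝ),
        IsBrownianMotion P W →
        ∀ b σ : ℝ → ℝ, LipschitzWith C₀ b → LipschitzWith C₁ σ → (∀ x, 0 ≤ σ x) →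
          |b 0| ≤ B₀ → |σ 0| ≤ B₁ →
          ∀ N : ℕ, 0 < N →
            ∫⁻ ω, ENNReal.ofReal (⨆ t ∈ Set.Icc (0 : ℝ) 1, |monEM W N b σ x₀ t ω| ^ p) ∂P
              ≤ ENNReal.ofReal C := by
  set n0 := 2 * ⌈p⌉₊ with hn0
  have hn0e : Even n0 := even_two_mul _
  set K : ℝ := (B₀ + C₀ : ℝ) + (B₁ + C₁) with hK
  refine ⟨1 + |xB K x₀ n0|, by positivity, ?_⟩
  intro Ω _ P W hW b σ hb hσ _ hb0 hσ0 N hN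
  haveI := hW.isProb
  have hS := fun n : ℕ => discSys_Xd hW hN (Nat.succ_pos n) (Ah N) hb hσ hb0 hσ0 x₀
  let R : ℕ → Ω → ℝ := fun n ω =>
    (rmax (fun i => Xd W N (n + 1) (Ah N) b σ x₀ i ω ^ (n0 + 2)) (N * (n + 1))) ^ 2
  have hRal : ∀ n, AL P (R n) := fun n => ((hS n).al_rmax (n0 + 2) (N * (n + 1))).powr 2
  have hRint : ∀ n, ∫⁻ ω, ENNReal.ofReal (R n ω) ∂P ≤ ENNReal.ofReal |xB K x₀ n0| := by
    intro n
    rw [← ofReal_integral_eq_lintegral_ofReal (hRal n).intg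
      (Filter.Eventually.of_forall fun ω => sq_nonneg _)]
    exact ENNReal.ofReal_le_ofReal (((hS n).rmax_moment n0 hn0e).trans (le_abs_self _))
  have hex : ∀ᵐ ω ∂P, ∀ k : ℕ, ∃ s, (k : ℝ) * (1 / N) ≤ s ∧
      Ah N ≤ |W s ω - W ((k : ℝ) * (1 / N)) ω| :=
    ae_all_iff.2 fun k => ae_exit hW _ _ (by positivity)
  have hpt : ∀ᵐ ω ∂P, ENNReal.ofReal (⨆ t ∈ Set.Icc (0 : ℝ) 1, |monEM W N b σ x₀ t ω| ^ p) ≤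
      1 + Filter.liminf (fun n => ENNReal.ofReal (R n ω)) Filter.atTop := by
    filter_upwards [hW.cont, hex] with ω hc hω
    set ℓ := Filter.liminf (fun n => ENNReal.ofReal (R n ω)) Filter.atTop with hℓ
    by_cases htop : ℓ = ⊤
    · rw [htop]; simp
    refine ENNReal.ofReal_le_of_le_toReal ?_
    refine Real.iSup_le (fun t => Real.iSup_le (fun ht => ?_) ENNReal.toReal_nonneg)
      ENNReal.toReal_nonneg
    refine (rpow_le_pow p hp _).trans ?_
    rw [ENNReal.toReal_add ENNReal.one_ne_top htop, ENNReal.toReal_one]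
    refine add_le_add le_rfl ?_
    rw [← ENNReal.ofReal_le_iff_le_toReal htop]
    obtain ⟨j, hj, hlim⟩ := Xd_tendsto hN hb.continuous hσ.continuous x₀ hc hω t ht.1 ht.2
    have hl2 := ENNReal.tendsto_ofReal ((hlim.pow (n0 + 2)).pow 2)
    rw [← hn0, ← hl2.liminf_eq]
    refine Filter.liminf_le_liminf (Filter.Eventually.of_forall fun n => ?_)
    refine ENNReal.ofReal_le_ofReal ?_
    refine pow_le_pow_left₀ ((hn0e.add even_two).pow_nonneg _) ?_ 2
    exact le_rmax (fun i => Xd W N (n + 1) (Ah N) b σ x₀ i ω ^ (n0 + 2)) (hj n)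
  calc _ ≤ ∫⁻ ω, (1 + Filter.liminf (fun n => ENNReal.ofReal (R n ω)) Filter.atTop) ∂P :=
        lintegral_mono_ae hpt
    _ = 1 + ∫⁻ ω, Filter.liminf (fun n => ENNReal.ofReal (R n ω)) Filter.atTop ∂P := by
        rw [lintegral_add_left measurable_const]; simp
    _ ≤ 1 + Filter.liminf (fun n => ∫⁻ ω, ENNReal.ofReal (R n ω) ∂P) Filter.atTop := by
        gcongr
        exact lintegral_liminf_le fun n => (hRal n).1.ennreal_ofReal
    _ ≤ 1 + ENNReal.ofReal |xB K x₀ n0| := by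
        gcongr
        refine (Filter.liminf_le_liminf (Filter.Eventually.of_forall hRint)).trans ?_
        simp
    _ = ENNReal.ofReal (1 + |xB K x₀ n0|) := by
        rw [ENNReal.ofReal_add zero_le_one (abs_nonneg _), ENNReal.ofReal_one]
end
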